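/- arXiv:1109.3057 — 2 statements merged into one kernel-verified Lean document; each statement's English description precedes it below -/
import Mathlib

section
/- Let B be an m×m complex matrix, D an n×n complex matrix, C an n×m complex matrix, and suppose the block matrix A = [[B, Cᴴ],[C, D]] (of size (m+n)×(m+n)) is positive semidefinite. Then for every real q with 1 ≤ q ≤ 2, Tr(A^q) ≤ (2^q - 2)·Tr((CᴴC)^{q/2}) + Tr(B^q) + Tr(D^q). -/
open ComplexOrder Matrix

/-- For a positive semidefinite matrix `M` over `ℂ` (indexed by an arbitrary finite type)
and `q : ℝ`, the matrix power `M^q` via the continuous functional calculus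
(applying `x ↦ x^q` to the eigenvalues). -/
noncomputable def matrixRpow {ι : Type*} [Fintype ι] [DecidableEq ι]
    (M : Matrix ι ι ℂ) (q : ℝ) : Matrix ι ι ℂ :=
  cfc (fun x : ℝ => x ^ q) M


/-- sorted spectral decomposition -/
lemma nc_spectral {k : ℕ} {M : Matrix (Fin k) (Fin k) ℂ} (hM : M.IsHermitian) :
    ∃ (W : Matrix (Fin k) (Fin k) ℂ) (e : Equiv.Perm (Fin k)), Wᴴ * W = 1 ∧ W * Wᴴ = 1 ∧
      Antitone (hM.eigenvalues ∘ e) ∧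
      M = W * diagonal (fun i => (((hM.eigenvalues ∘ e) i : ℝ) : ℂ)) * Wᴴ := by
  classical
  set e0 := Tuple.sort (fun i => - hM.eigenvalues i) with he0
  have hmono : Monotone ((fun i => - hM.eigenvalues i) ∘ e0) := Tuple.monotone_sort _
  have hU1 : (hM.eigenvectorUnitary : Matrix (Fin k) (Fin k) ℂ)ᴴ * (hM.eigenvectorUnitary : Matrix (Fin k) (Fin k) ℂ) = 1 := by
    have := Unitary.coe_star_mul_self hM.eigenvectorUnitary
    simpa [star_eq_conjTranspose] using this
  have hU2 : (hM.eigenvectorUnitary : Matrix (Fin k) (Fin k) ℂ) * (hM.eigenvectorUnitary : Matrix (Fin k) (Fin k) ℂ)ᴴ = 1 :=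
    mul_eq_one_comm.mp hU1
  set U := (hM.eigenvectorUnitary : Matrix (Fin k) (Fin k) ℂ) with hU
  have hs : M = U * diagonal (fun i => ((hM.eigenvalues i : ℝ) : ℂ)) * Uᴴ := by
    have := hM.spectral_theorem
    rw [Unitary.conjStarAlgAut_apply] at this
    exact this
  refine ⟨U.submatrix id e0, e0, ?_, ?_, ?_, ?_⟩
  · have := submatrix_mul_equiv Uᴴ U e0 (Equiv.refl _) e0
    rw [Equiv.coe_refl] at this
    rw [conjTranspose_submatrix, this, hU1]; simp
  · have := submatrix_mul_equiv U Uᴴ id e0 id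
    rw [conjTranspose_submatrix, this, hU2]; simp
  · intro i j hij
    have := hmono hij
    simp only [Function.comp] at this ⊢
    linarith
  · conv_lhs => rw [hs]
    have h1 := submatrix_mul_equiv U (diagonal (fun i => ((hM.eigenvalues i : ℝ) : ℂ))) id e0 e0
    have h2 := submatrix_mul_equiv (U * diagonal (fun i => ((hM.eigenvalues i : ℝ) : ℂ))) Uᴴ id e0 id
    rw [submatrix_diagonal_equiv] at h1
    rw [conjTranspose_submatrix]
    have h3 : (fun i => (((hM.eigenvalues ∘ e0) i : ℝ) : ℂ)) = (fun i => ((hM.eigenvalues i : ℝ) : ℂ)) ∘ e0 := rfl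
    rw [h3, h1, h2]; simp

lemma nc_interlace {k m : ℕ} (L : Matrix (Fin m) (Fin k) ℂ) (hL : Lᴴ * L = 1)
    (μ : Fin k → ℝ) (ν : Fin m → ℝ) (hμ : Antitone μ) (hν : Antitone ν)
    (h : (Lᴴ * diagonal (fun i => (ν i : ℂ)) * L - diagonal (fun i => (μ i : ℂ))).PosSemidef)
    (i : Fin k) (j : Fin m) (hij : i.val = j.val) : μ i ≤ ν j := by
  -- find z
  let T : (Fin (i.val + 1) → ℂ) →ₗ[ℂ] (Fin i.val → ℂ) :=
    { toFun := fun z a => ∑ b : Fin (i.val + 1), L ⟨a.val, by omega⟩ ⟨b.val, by omega⟩ * z b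
      map_add' := by intro x y; ext a; simp [mul_add, Finset.sum_add_distrib]
      map_smul' := by
        intro c x; ext a; simp only [Pi.smul_apply, smul_eq_mul, Finset.mul_sum, RingHom.id_apply]
        exact Finset.sum_congr rfl fun _ _ => by ring }
  have hker : LinearMap.ker T ≠ ⊥ := LinearMap.ker_ne_bot_of_finrank_lt (by simp)
  obtain ⟨z, hz, hz0⟩ := Submodule.exists_mem_ne_zero_of_ne_bot hker
  let y : Fin k → ℂ := fun b => if hb : b.val < i.val + 1 then z ⟨b.val, hb⟩ else 0
  have hy1 : ∀ b : Fin k, ∀ hb : b.val < i.val + 1, y b = z ⟨b.val, hb⟩ := fun b hb => dif_pos hb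
  have hy2 : ∀ b : Fin k, ¬ b.val < i.val + 1 → y b = 0 := fun b hb => dif_neg hb
  have hy0 : y ≠ 0 := by
    intro h0; apply hz0; ext b
    have := congrFun h0 ⟨b.val, by omega⟩
    rwa [hy1 _ b.isLt] at this
  have hLy : ∀ a : Fin m, a.val < i.val → (L *ᵥ y) a = 0 := by
    intro a ha
    have h1 := congrFun (LinearMap.mem_ker.mp hz) ⟨a.val, ha⟩
    simp only [T, LinearMap.coe_mk, AddHom.coe_mk, Pi.zero_apply] at h1
    rw [← h1]
    simp only [mulVec, dotProduct]
    symm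
    have hk : i.val + 1 ≤ k := by omega
    apply Finset.sum_of_injOn (fun b : Fin (i.val+1) => Fin.castLE hk b)
    · intro x _ y _ hxy; exact Fin.castLE_injective hk hxy
    · intro x _; simp
    · intro b _ hb
      have : ¬ b.val < i.val + 1 := fun hlt => hb ⟨⟨b.val, hlt⟩, by simp, by ext; simp⟩
      simp [hy2 b this]
    · intro b _
      rw [hy1 (Fin.castLE hk b) b.isLt]
      rfl
  have hnorm : ∑ a, Complex.normSq ((L *ᵥ y) a) = ∑ b, Complex.normSq (y b) := by
    have : star (L *ᵥ y) ⬝ᵥ (L *ᵥ y) = star y ⬝ᵥ y := by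
      rw [star_mulVec, ← dotProduct_mulVec, mulVec_mulVec, hL, one_mulVec]
    have e : ∀ {p : ℕ} (v : Fin p → ℂ), star v ⬝ᵥ v = ((∑ a, Complex.normSq (v a) : ℝ) : ℂ) := by
      intro p v; simp [dotProduct, Complex.normSq_eq_conj_mul_self]
    rw [e, e] at this
    exact_mod_cast this
  have hquad : ∑ b, μ b * Complex.normSq (y b) ≤ ∑ a, ν a * Complex.normSq ((L *ᵥ y) a) := by
    have h1 := h.dotProduct_mulVec_nonneg y
    rw [sub_mulVec, dotProduct_sub, ← mulVec_mulVec, ← mulVec_mulVec] at h1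
    rw [dotProduct_mulVec (star y) Lᴴ, ← star_mulVec] at h1
    have e : ∀ {p : ℕ} (v : Fin p → ℂ) (d : Fin p → ℝ), star v ⬝ᵥ ((diagonal (fun i => (d i : ℂ))) *ᵥ v) = ((∑ a, d a * Complex.normSq (v a) : ℝ) : ℂ) := by
      intro p v d; simp [dotProduct, Complex.normSq_eq_conj_mul_self, mulVec_diagonal]
      exact Finset.sum_congr rfl fun _ _ => by ring
    rw [e, e, ← Complex.ofReal_sub] at h1
    have := Complex.zero_le_real.mp h1
    linarith
  have hpos : 0 < ∑ b, Complex.normSq (y b) := by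
    obtain ⟨b, hb⟩ := Function.ne_iff.mp hy0
    exact Finset.sum_pos' (fun _ _ => Complex.normSq_nonneg _) ⟨b, Finset.mem_univ _, Complex.normSq_pos.mpr hb⟩
  have hl : μ i * ∑ b, Complex.normSq (y b) ≤ ∑ b, μ b * Complex.normSq (y b) := by
    rw [Finset.mul_sum]
    apply Finset.sum_le_sum; intro b _
    by_cases hb : b.val < i.val + 1
    · exact mul_le_mul_of_nonneg_right (hμ (by rw [Fin.le_def]; omega)) (Complex.normSq_nonneg _)
    · simp [hy2 b hb]
  have hr : ∑ a, ν a * Complex.normSq ((L *ᵥ y) a) ≤ ν j * ∑ b, Complex.normSq (y b) := by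
    rw [← hnorm, Finset.mul_sum]
    apply Finset.sum_le_sum; intro a _
    by_cases ha : a.val < i.val
    · simp [hLy a ha]
    · exact mul_le_mul_of_nonneg_right (hν (by rw [Fin.le_def]; omega)) (Complex.normSq_nonneg _)
  exact le_of_mul_le_mul_right (hl.trans (hquad.trans hr)) hpos

lemma nc_det_diag {k : ℕ} {W : Matrix (Fin k) (Fin k) ℂ} (h : W * Wᴴ = 1) (d : Fin k → ℂ) :
    (W * diagonal d * Wᴴ).det = ∏ i, d i := by
  have h1 : W.det * Wᴴ.det = 1 := by rw [← det_mul, h, det_one]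
  rw [det_mul, det_mul, det_diagonal]
  linear_combination (∏ i, d i) * h1

lemma nc_add_diag {k : ℕ} {W : Matrix (Fin k) (Fin k) ℂ} (h : W * Wᴴ = 1) (d : Fin k → ℂ) (a c : ℂ) :
    a • (1 : Matrix (Fin k) (Fin k) ℂ) + c • (W * diagonal d * Wᴴ) = W * diagonal (fun i => a + c * d i) * Wᴴ := by
  have : diagonal (fun i => a + c * d i) = a • (1 : Matrix (Fin k) (Fin k) ℂ) + c • diagonal d := by
    ext i j
    by_cases hij : i = j
    · subst hij; simp
    · simp [hij]
  rw [this, mul_add, add_mul]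
  simp [h]

lemma nc_det_one_add {k : ℕ} {M : Matrix (Fin k) (Fin k) ℂ} (hM : M.IsHermitian) (a c : ℝ) :
    ((a : ℂ) • (1 : Matrix (Fin k) (Fin k) ℂ) + (c : ℂ) • M).det = ((∏ i, (a + c * hM.eigenvalues i) : ℝ) : ℂ) := by
  obtain ⟨W, e, -, h2, -, h4⟩ := nc_spectral hM
  conv_lhs => rw [h4, nc_add_diag h2, nc_det_diag h2]
  rw [← Equiv.prod_comp e (fun i => a + c * hM.eigenvalues i)]
  push_cast
  rfl

lemma nc_factor {k : ℕ} {M : Matrix (Fin k) (Fin k) ℂ} (hM : M.PosDef) :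
    ∃ R : Matrix (Fin k) (Fin k) ℂ, IsUnit R.det ∧ M = Rᴴ * R := by
  obtain ⟨W, e, h1, h2, -, h4⟩ := nc_spectral hM.1
  refine ⟨diagonal (fun i => ((Real.sqrt (hM.1.eigenvalues (e i)) : ℝ) : ℂ)) * Wᴴ, ?_, ?_⟩
  · rw [det_mul, det_diagonal]
    apply IsUnit.mul
    · rw [isUnit_iff_ne_zero, Finset.prod_ne_zero_iff]
      intro i _
      exact_mod_cast (Real.sqrt_pos.mpr (hM.eigenvalues_pos _)).ne'
    · have : Wᴴ.det * W.det = 1 := by rw [← det_mul, h1, det_one]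
      exact IsUnit.of_mul_eq_one _ this
  · conv_lhs => rw [h4]
    rw [conjTranspose_mul, conjTranspose_conjTranspose, diagonal_conjTranspose, Matrix.mul_assoc W, Matrix.mul_assoc W, ← Matrix.mul_assoc (diagonal _) (diagonal _), diagonal_mul_diagonal]
    congr 3
    ext i
    simp only [Function.comp, Pi.star_apply]
    have := Real.mul_self_sqrt (hM.eigenvalues_pos (e i)).le
    have h6 : ∀ x : ℝ, star (x : ℂ) * (x : ℂ) = ((x * x : ℝ) : ℂ) := by
      intro x
      simp
    rw [h6, this]

lemma nc_det_mono {k : ℕ} {N P : Matrix (Fin k) (Fin k) ℂ} (hN : N.PosDef) (hP : P.PosSemidef) :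
    N.det ≤ (N + P).det := by
  obtain ⟨R, hR, rfl⟩ := nc_factor hN
  have hP' := hP.conjTranspose_mul_mul_same (R⁻¹)
  have h1 : R⁻¹ * R = 1 := nonsing_inv_mul _ hR
  have h1' : Rᴴ * (R⁻¹)ᴴ = 1 := by rw [← conjTranspose_mul, h1, conjTranspose_one]
  have h2 : Rᴴ * R + P = Rᴴ * (((1 : ℝ) : ℂ) • (1 : Matrix (Fin k) (Fin k) ℂ) + ((1 : ℝ) : ℂ) • ((R⁻¹)ᴴ * P * R⁻¹)) * R := by
    simp only [Complex.ofReal_one, one_smul, mul_add, add_mul, mul_one]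
    congr 1
    calc P = (Rᴴ * (R⁻¹)ᴴ) * P * (R⁻¹ * R) := by rw [h1, h1']; simp
      _ = _ := by simp only [Matrix.mul_assoc]
  rw [h2, det_mul, det_mul, det_mul, nc_det_one_add hP'.1]
  have h3 : (0 : ℂ) ≤ Rᴴ.det * R.det := by
    rw [← det_mul]; exact (posSemidef_conjTranspose_mul_self R).det_nonneg
  have h4 : (1 : ℝ) ≤ ∏ i, (1 + 1 * hP'.1.eigenvalues i) := by
    refine le_of_eq_of_le (Finset.prod_const_one (s := (Finset.univ : Finset (Fin k)))).symm ?_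
    apply Finset.prod_le_prod (fun _ _ => zero_le_one)
    intro i _; have := hP'.eigenvalues_nonneg i; linarith
  have h5 : (1 : ℂ) ≤ ((∏ i, (1 + 1 * hP'.1.eigenvalues i) : ℝ) : ℂ) := by exact_mod_cast h4
  calc Rᴴ.det * R.det = (Rᴴ.det * R.det) * 1 := by ring
    _ ≤ (Rᴴ.det * R.det) * _ := mul_le_mul_of_nonneg_left h5 h3
    _ = _ := by ring

lemma nc_det_block {k : ℕ} {X Y Z : Matrix (Fin k) (Fin k) ℂ} (hX : X.PosDef) (hZ : IsUnit Z.det)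
    (h : (fromBlocks X Zᴴ Z Y).PosSemidef) : Zᴴ.det * Z.det ≤ X.det * Y.det := by
  have := hX.isUnit.invertible
  have h1 := (PosDef.fromBlocks₁₁ (A := X) Zᴴ Y hX).mp (by simpa using h)
  rw [conjTranspose_conjTranspose] at h1
  have hN : (Z * X⁻¹ * Zᴴ).PosDef := by
    have := (IsUnit.posDef_star_right_conjugate_iff (x := X⁻¹) ((isUnit_iff_isUnit_det Z).mpr hZ)).mpr hX.inv
    simpa [star_eq_conjTranspose] using this
  have h2 := nc_det_mono hN h1
  rw [add_sub_cancel, det_mul, det_mul] at h2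
  have h3 : X.det * (X⁻¹).det = 1 := by
    rw [← det_mul, mul_nonsing_inv _ ((isUnit_iff_isUnit_det X).mp hX.isUnit), det_one]
  calc Zᴴ.det * Z.det = X.det * (Z.det * (X⁻¹).det * Zᴴ.det) := by linear_combination (- Zᴴ.det * Z.det) * h3
    _ ≤ _ := mul_le_mul_of_nonneg_left h2 hX.det_pos.le

/-- `det(1+|C|)² ≤ det(1+B) det(1+D)` -/
lemma nc_key {k : ℕ} {B C D R : Matrix (Fin k) (Fin k) ℂ} (hR : R.IsHermitian) (hRu : IsUnit R.det)
    (hR1 : IsUnit (1 + R).det)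
    (hRC : R * R = Cᴴ * C) (hB : B.PosSemidef)
    (h : (fromBlocks B Cᴴ C D).PosSemidef) :
    (1 + R).det * (1 + R).det ≤ (1 + B).det * (1 + D).det := by
  have hi1 : R⁻¹ * R = 1 := nonsing_inv_mul _ hRu
  have hi2 : R * R⁻¹ = 1 := mul_nonsing_inv _ hRu
  have hRi : (R⁻¹)ᴴ = R⁻¹ := by rw [conjTranspose_nonsing_inv, hR.eq]
  set V := C * R⁻¹ with hV
  have hV1 : Vᴴ * V = 1 := by
    rw [hV, conjTranspose_mul, hRi, Matrix.mul_assoc, ← Matrix.mul_assoc Cᴴ, ← hRC, Matrix.mul_assoc R, hi2, mul_one, hi1]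
  have hV2 : V * Vᴴ = 1 := mul_eq_one_comm.mp hV1
  have hVR : V * (1 + R) = C + V := by
    rw [mul_add, mul_one, hV, Matrix.mul_assoc, hi1, mul_one, add_comm]
  have hps : (fromBlocks 1 Vᴴ V (1 : Matrix (Fin k) (Fin k) ℂ)).PosSemidef := by
    have : Invertible (1 : Matrix (Fin k) (Fin k) ℂ) := invertibleOne
    have := (PosDef.fromBlocks₁₁ (A := (1 : Matrix (Fin k) (Fin k) ℂ)) Vᴴ (1 : Matrix (Fin k) (Fin k) ℂ) PosDef.one)
    rw [conjTranspose_conjTranspose] at this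
    apply this.mpr
    simp [hV2, PosSemidef.zero]
  have hsum := hps.add h
  rw [fromBlocks_add] at hsum
  have hdet : (C + V).det = V.det * (1 + R).det := by rw [← hVR, det_mul]
  have hVd : Vᴴ.det * V.det = 1 := by rw [← det_mul, hV1, det_one]
  have hVu : IsUnit V.det := IsUnit.of_mul_eq_one _ (by rw [mul_comm]; exact hVd)
  have hfin := nc_det_block (X := 1 + B) (Y := 1 + D) (Z := C + V) (PosDef.one.add_posSemidef hB)
    (by rw [hdet]; exact hVu.mul hR1) (by rw [conjTranspose_add, add_comm Cᴴ, add_comm C]; exact hsum)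
  have h1 : (C + V)ᴴ = (1 + R) * Vᴴ := by
    rw [← hVR, conjTranspose_mul, conjTranspose_add, conjTranspose_one, hR.eq]
  rw [h1, det_mul, hdet] at hfin
  calc _ = _ := ?_
    _ ≤ _ := hfin
  linear_combination (- (1 + R).det * (1 + R).det) * hVd

lemma nc_proj {n k : ℕ} {J : Matrix (Fin n) (Fin k) ℂ} (hJ : Jᴴ * J = 1) :
    (1 - J * Jᴴ).PosSemidef := by
  have h : 1 - J * Jᴴ = (1 - J * Jᴴ)ᴴ * (1 - J * Jᴴ) := by
    have h1 : (J * Jᴴ) * (J * Jᴴ) = J * Jᴴ := by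
      rw [Matrix.mul_assoc, ← Matrix.mul_assoc Jᴴ, hJ, Matrix.one_mul]
    rw [conjTranspose_sub, conjTranspose_one, conjTranspose_mul, conjTranspose_conjTranspose,
      sub_mul, mul_sub, mul_sub, h1]
    simp
  rw [h]; exact posSemidef_conjTranspose_mul_self _

lemma nc_gram {p k : ℕ} {X : Matrix (Fin p) (Fin k) ℂ} {T : Matrix (Fin k) (Fin p) ℂ}
    {S : Matrix (Fin k) (Fin k) ℂ} (hS : IsUnit S.det) (h : T * X = S) :
    ∃ R : Matrix (Fin k) (Fin k) ℂ, IsUnit R.det ∧ Xᴴ * X = Rᴴ * R := by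
  apply nc_factor
  apply PosDef.conjTranspose_mul_self
  apply Function.LeftInverse.injective (g := fun v => S⁻¹ *ᵥ (T *ᵥ v))
  intro v
  simp only [mulVec_mulVec]
  rw [h, nonsing_inv_mul _ hS, one_mulVec]

lemma nc_prod {m n k : ℕ} (hk : k ≤ m) {B : Matrix (Fin m) (Fin m) ℂ} {D : Matrix (Fin n) (Fin n) ℂ}
    {C : Matrix (Fin n) (Fin m) ℂ} (hA : (fromBlocks B Cᴴ C D).PosSemidef)
    {X : Matrix (Fin m) (Fin k) ℂ} {Y : Matrix (Fin n) (Fin k) ℂ}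
    (hX : Xᴴ * (1 + B) * X = 1) (hY : Yᴴ * (1 + D) * Y = 1)
    (s : Fin k → ℝ) (hs : ∀ i, 0 < s i) (hS : Yᴴ * C * X = diagonal (fun i => (s i : ℂ)))
    {U : Matrix (Fin m) (Fin m) ℂ} (hU : U * Uᴴ = 1)
    (σ : Fin m → ℝ) (hσ : Antitone σ)
    (hC : Cᴴ * C = U * diagonal (fun i => (σ i : ℂ)) * Uᴴ) :
    ∏ i, s i ≤ ∏ i : Fin k, (√(σ (Fin.castLE hk i)) / (1 + √(σ (Fin.castLE hk i)))) := by
  set S := diagonal (fun i => (s i : ℂ)) with hSdef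
  have hSdet : S.det = ((∏ i, s i : ℝ) : ℂ) := by rw [hSdef, det_diagonal]; push_cast; rfl
  have hspos : 0 < ∏ i, s i := Finset.prod_pos fun i _ => hs i
  have hSu : IsUnit S.det := by
    rw [hSdet, isUnit_iff_ne_zero]; exact_mod_cast hspos.ne'
  have hSH : Sᴴ = S := by
    rw [hSdef, diagonal_conjTranspose]; congr 1; ext i; simp
  obtain ⟨R, hR, hG⟩ := nc_gram hSu hS
  obtain ⟨L, hL, hH⟩ := nc_gram (X := Y) (T := Xᴴ * Cᴴ) hSu (by
    rw [← hSH, ← hS]; simp [Matrix.mul_assoc])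
  have hRi : R * R⁻¹ = 1 := mul_nonsing_inv _ hR
  have hLi : L * L⁻¹ = 1 := mul_nonsing_inv _ hL
  have hRi' : (R⁻¹)ᴴ * Rᴴ = 1 := by rw [← conjTranspose_mul, hRi, conjTranspose_one]
  have hLi' : (L⁻¹)ᴴ * Lᴴ = 1 := by rw [← conjTranspose_mul, hLi, conjTranspose_one]
  set Ri := R⁻¹
  set Li := L⁻¹
  have hRid : IsUnit Ri.det := IsUnit.of_mul_eq_one (R.det) (by rw [mul_comm, ← det_mul, hRi, det_one])
  have hLid : IsUnit Li.det := IsUnit.of_mul_eq_one (L.det) (by rw [mul_comm, ← det_mul, hLi, det_one])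
  set JX := X * Ri with hJX
  set JY := Y * Li with hJY
  have hJX1 : JXᴴ * JX = 1 := by
    calc JXᴴ * JX = Riᴴ * (Xᴴ * X) * Ri := by rw [hJX, conjTranspose_mul]; simp only [Matrix.mul_assoc]
      _ = (Riᴴ * Rᴴ) * (R * Ri) := by rw [hG]; simp only [Matrix.mul_assoc]
      _ = 1 := by rw [hRi, hRi', mul_one]
  have hJY1 : JYᴴ * JY = 1 := by
    calc JYᴴ * JY = Liᴴ * (Yᴴ * Y) * Li := by rw [hJY, conjTranspose_mul]; simp only [Matrix.mul_assoc]
      _ = (Liᴴ * Lᴴ) * (L * Li) := by rw [hH]; simp only [Matrix.mul_assoc]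
      _ = 1 := by rw [hLi, hLi', mul_one]
  set Bk := JXᴴ * B * JX with hBk
  set Ck := JYᴴ * C * JX with hCk
  set Dk := JYᴴ * D * JY with hDk
  have hAk : (fromBlocks Bk Ckᴴ Ck Dk).PosSemidef := by
    have := hA.conjTranspose_mul_mul_same (fromBlocks JX 0 0 JY)
    rw [fromBlocks_conjTranspose, fromBlocks_multiply, fromBlocks_multiply] at this
    simp only [conjTranspose_zero, Matrix.zero_mul, Matrix.mul_zero, add_zero, zero_add] at this
    convert this using 2
    rw [hCk]; simp [Matrix.mul_assoc]
  have hBk0 : Bk.PosSemidef := by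
    have := hAk.submatrix Sum.inl
    convert this using 1
    ext i j; rfl
  have h1B : 1 + Bk = Riᴴ * Ri := by
    calc 1 + Bk = JXᴴ * (1 + B) * JX := by rw [Matrix.mul_add, Matrix.add_mul, Matrix.mul_one, hJX1]
      _ = Riᴴ * (Xᴴ * (1 + B) * X) * Ri := by rw [hJX, conjTranspose_mul]; simp only [Matrix.mul_assoc]
      _ = _ := by rw [hX, mul_one]
  have h1D : 1 + Dk = Liᴴ * Li := by
    calc 1 + Dk = JYᴴ * (1 + D) * JY := by rw [Matrix.mul_add, Matrix.add_mul, Matrix.mul_one, hJY1]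
      _ = Liᴴ * (Yᴴ * (1 + D) * Y) * Li := by rw [hJY, conjTranspose_mul]; simp only [Matrix.mul_assoc]
      _ = _ := by rw [hY, mul_one]
  have hCkS : Ck = Liᴴ * S * Ri := by
    rw [← hS, hCk, hJX, hJY, conjTranspose_mul]; simp only [Matrix.mul_assoc]
  have hLiHd : IsUnit Liᴴ.det := by rw [det_conjTranspose]; exact hLid.star
  have hCkd : IsUnit Ck.det := by
    rw [hCkS, det_mul, det_mul]; exact (hLiHd.mul hSu).mul hRid
  have hM : (Ckᴴ * Ck).PosDef := by
    have h0 := posSemidef_conjTranspose_mul_self Ck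
    rw [h0.posDef_iff_det_ne_zero, det_mul, det_conjTranspose]
    exact mul_ne_zero (star_ne_zero.mpr hCkd.ne_zero) hCkd.ne_zero
  obtain ⟨W, e, hW1, hW2, hμ, hMW⟩ := nc_spectral hM.1
  have hμpos : ∀ i, 0 < (hM.1.eigenvalues ∘ e) i := fun i => hM.eigenvalues_pos _
  set μ := hM.1.eigenvalues ∘ e with hμdef
  set Q := W * diagonal (fun i => ((√(μ i) : ℝ) : ℂ)) * Wᴴ with hQ
  have hQQ : Q * Q = Ckᴴ * Ck := by
    rw [hMW]
    calc Q * Q = W * (diagonal (fun i => ((√(μ i) : ℝ) : ℂ)) * (Wᴴ * W) * diagonal (fun i => ((√(μ i) : ℝ) : ℂ))) * Wᴴ := by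
          rw [hQ]; simp only [Matrix.mul_assoc]
      _ = _ := by
          rw [hW1, mul_one, diagonal_mul_diagonal]
          congr 3
          ext i
          rw [← Complex.ofReal_mul, Real.mul_self_sqrt (hμpos i).le]
  have hQdet : Q.det = ((∏ i, √(μ i) : ℝ) : ℂ) := by rw [hQ, nc_det_diag hW2]; push_cast; rfl
  have hQ1det : (1 + Q).det = ((∏ i, (1 + √(μ i)) : ℝ) : ℂ) := by
    have := nc_add_diag hW2 (fun i => ((√(μ i) : ℝ) : ℂ)) 1 1
    rw [one_smul, one_smul] at this
    rw [hQ, this, nc_det_diag hW2]; push_cast; simp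
  have hQH : Q.IsHermitian := by
    unfold IsHermitian
    rw [hQ, conjTranspose_mul, conjTranspose_mul, conjTranspose_conjTranspose, diagonal_conjTranspose, Matrix.mul_assoc]
    congr 3
    ext i; simp
  have hp1 : 0 < ∏ i, √(μ i) := Finset.prod_pos fun i _ => Real.sqrt_pos.mpr (hμpos i)
  have hp2 : 0 < ∏ i, (1 + √(μ i)) := Finset.prod_pos fun i _ => by positivity
  have hkey := nc_key hQH (by rw [hQdet, isUnit_iff_ne_zero]; exact_mod_cast hp1.ne')
    (by rw [hQ1det, isUnit_iff_ne_zero]; exact_mod_cast hp2.ne') hQQ hBk0 hAk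
  have hdet1 : Q.det * Q.det = (S.det * S.det) * ((1 + Bk).det * (1 + Dk).det) := by
    rw [← det_mul, hQQ, h1B, h1D, hCkS]
    simp only [conjTranspose_mul, conjTranspose_conjTranspose, hSH, det_mul]
    ring
  have hS2 : (0 : ℂ) ≤ S.det * S.det := by
    rw [hSdet, ← Complex.ofReal_mul, Complex.zero_le_real]; positivity
  have hfin := mul_le_mul_of_nonneg_left hkey hS2
  rw [← hdet1, hQdet, hQ1det, hSdet] at hfin
  have hfin' : ((∏ i, s i) * ∏ i, (1 + √(μ i))) ^ 2 ≤ (∏ i, √(μ i)) ^ 2 := by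
    have : (∏ i, s i) * (∏ i, s i) * ((∏ i, (1 + √(μ i))) * ∏ i, (1 + √(μ i))) ≤ (∏ i, √(μ i)) * ∏ i, √(μ i) := by
      exact_mod_cast hfin
    nlinarith [this]
  have hfin2 := (pow_le_pow_iff_left₀ (by positivity) hp1.le two_ne_zero).mp hfin'
  have hinter : ∀ i, μ i ≤ σ (Fin.castLE hk i) := by
    intro i
    have hU' : Uᴴ * U = 1 := mul_eq_one_comm.mp hU
    refine nc_interlace (Uᴴ * JX * W) ?_ μ σ hμ hσ ?_ i _ rfl
    · calc (Uᴴ * JX * W)ᴴ * (Uᴴ * JX * W) = Wᴴ * (JXᴴ * (U * Uᴴ) * JX) * W := by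
            simp only [conjTranspose_mul, conjTranspose_conjTranspose, Matrix.mul_assoc]
        _ = 1 := by rw [hU, Matrix.mul_one, hJX1, mul_one, hW1]
    · have hdμ : diagonal (fun i => (μ i : ℂ)) = Wᴴ * (Ckᴴ * Ck) * W := by
        rw [hMW]
        calc _ = (Wᴴ * W) * diagonal (fun i => (μ i : ℂ)) * (Wᴴ * W) := by rw [hW1]; simp
          _ = _ := by simp only [Matrix.mul_assoc]
      have hps := ((nc_proj hJY1).conjTranspose_mul_mul_same (C * JX * W))
      convert hps using 1
      rw [hdμ]
      have e1 : (Uᴴ * JX * W)ᴴ * diagonal (fun i => (σ i : ℂ)) * (Uᴴ * JX * W) = (C * JX * W)ᴴ * (C * JX * W) := by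
        calc _ = (JX * W)ᴴ * (U * diagonal (fun i => (σ i : ℂ)) * Uᴴ) * (JX * W) := by
              simp only [conjTranspose_mul, conjTranspose_conjTranspose, Matrix.mul_assoc]
          _ = _ := by rw [← hC]; simp only [conjTranspose_mul, Matrix.mul_assoc]
      rw [e1, hCk, Matrix.mul_sub, Matrix.sub_mul, Matrix.mul_one]
      congr 1
      simp only [conjTranspose_mul, conjTranspose_conjTranspose, Matrix.mul_assoc]
  calc ∏ i, s i ≤ (∏ i, √(μ i)) / ∏ i, (1 + √(μ i)) := by rw [le_div_iff₀ hp2]; exact hfin2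
    _ = ∏ i, (√(μ i) / (1 + √(μ i))) := by rw [Finset.prod_div_distrib]
    _ ≤ _ := by
      apply Finset.prod_le_prod
      · intro i _; positivity
      · intro i _
        have h1 := Real.sqrt_le_sqrt (hinter i)
        have h2 := Real.sqrt_nonneg (μ i)
        rw [div_le_div_iff₀ (by positivity) (by positivity)]
        nlinarith

lemma nc_abel (w a : ℕ → ℝ) (n : ℕ) (hw0 : ∀ i < n, 0 ≤ w i) (hw : ∀ i, i + 1 < n → w (i+1) ≤ w i)
    (hS : ∀ k ≤ n, ∑ i ∈ Finset.range k, a i ≤ 0) : ∑ i ∈ Finset.range n, w i * a i ≤ 0 := by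
  have key : ∀ k, k + 1 ≤ n → ∑ i ∈ Finset.range (k+1), w i * a i ≤ w k * ∑ i ∈ Finset.range (k+1), a i := by
    intro k
    induction k with
    | zero => intro _; simp
    | succ k ih =>
      intro hk
      rw [Finset.sum_range_succ, Finset.sum_range_succ a, mul_add]
      have h1 := ih (by omega)
      have h2 := hw k (by omega)
      have h3 := hS (k+1) (by omega)
      nlinarith
  rcases n with _ | n
  · simp
  · have h1 := key n le_rfl
    have h2 := hS (n+1) le_rfl
    have h3 := hw0 n (by omega)
    nlinarith [mul_nonneg h3 (neg_nonneg.mpr h2)]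

/-- tangent line inequality for `φ(u) = - log (1 - e^{2u})`. -/
lemma nc_tangent {s t : ℝ} (hs : 0 < s) (hs1 : s < 1) (ht : 0 < t) (ht1 : t < 1) :
    Real.log (1 - t^2) - Real.log (1 - s^2) ≤ (2 * s^2 / (1 - s^2)) * (Real.log s - Real.log t) := by
  have h1 : 0 < 1 - s^2 := by nlinarith
  have h2 : 0 < 1 - t^2 := by nlinarith
  -- weighted AM-GM: (1-s²) log((1-t²)/(1-s²)) + s² log (t²/s²) ≤ 0
  have e1 : Real.log ((1 - t^2)/(1-s^2)) ≤ (1 - t^2)/(1-s^2) - 1 := Real.log_le_sub_one_of_pos (by positivity)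
  have e2 : Real.log (t^2/s^2) ≤ t^2/s^2 - 1 := Real.log_le_sub_one_of_pos (by positivity)
  rw [Real.log_div h2.ne' h1.ne'] at e1
  rw [Real.log_div (by positivity) (by positivity), Real.log_pow, Real.log_pow] at e2
  push_cast at e2
  have e1' : (1-s^2) * (Real.log (1 - t^2) - Real.log (1 - s^2)) ≤ s^2 - t^2 := by
    calc _ ≤ (1-s^2) * ((1 - t^2)/(1-s^2) - 1) := mul_le_mul_of_nonneg_left e1 h1.le
      _ = _ := by field_simp; ring
  have e2' : s^2 * (2 * Real.log t - 2 * Real.log s) ≤ t^2 - s^2 := by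
    calc _ ≤ s^2 * (t^2/s^2 - 1) := mul_le_mul_of_nonneg_left e2 (by positivity)
      _ = _ := by field_simp
  rw [div_mul_eq_mul_div, le_div_iff₀ h1]
  nlinarith

lemma nc_major_nat (m : ℕ) (s t : ℕ → ℝ) (hs0 : ∀ i, 0 ≤ s i) (hs1 : ∀ i, s i < 1) (hs : ∀ i, i + 1 < m → s (i+1) ≤ s i)
    (ht0 : ∀ i, 0 ≤ t i) (ht1 : ∀ i, t i < 1)
    (h : ∀ k ≤ m, (∀ i < k, 0 < s i) → ∏ i ∈ Finset.range k, s i ≤ ∏ i ∈ Finset.range k, t i) :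
    ∑ i ∈ Finset.range m, Real.log (1 - t i ^ 2) ≤ ∑ i ∈ Finset.range m, Real.log (1 - s i ^ 2) := by
  induction m with
  | zero => simp
  | succ m ih =>
    by_cases hm : 0 < s m
    · -- all positive
      have hpos : ∀ i, i ≤ m → 0 < s i := by
        intro i hi
        have : ∀ j, j ≤ m → 0 < s (m - j) := by
          intro j
          induction j with
          | zero => intro _; simpa using hm
          | succ j ihj =>
            intro hj
            have h1 := ihj (by omega)
            have h2 := hs (m - (j+1)) (by omega)
            rw [show m - (j+1) + 1 = m - j by omega] at h2
            linarith
        have := this (m - i) (by omega)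
        rwa [show m - (m - i) = i by omega] at this
      have htpos : ∀ i, i ≤ m → 0 < t i := by
        intro i hi
        have h1 := h (m+1) le_rfl (fun i hi => hpos i (by omega))
        have h2 : 0 < ∏ i ∈ Finset.range (m+1), s i := Finset.prod_pos fun i hi => hpos i (by
          have := Finset.mem_range.mp hi; omega)
        have h3 := (h2.trans_le h1).ne'
        rw [Finset.prod_ne_zero_iff] at h3
        exact lt_of_le_of_ne (ht0 i) (h3 i (Finset.mem_range.mpr (by omega))).symm
      have hab := nc_abel (fun i => 2 * s i^2/(1 - s i^2)) (fun i => Real.log (s i) - Real.log (t i)) (m+1) ?_ ?_ ?_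
      · have : ∑ i ∈ Finset.range (m+1), (Real.log (1 - t i ^ 2) - Real.log (1 - s i ^ 2)) ≤ 0 := by
          refine le_trans (Finset.sum_le_sum fun i hi => ?_) hab
          have hi' := Finset.mem_range.mp hi
          exact nc_tangent (hpos i (by omega)) (hs1 i) (htpos i (by omega)) (ht1 i)
        rw [Finset.sum_sub_distrib] at this
        linarith
      · intro i _
        have h1 : 0 < 1 - s i^2 := by nlinarith [hs0 i, hs1 i]
        positivity
      · intro i hi
        have h1 : 0 < 1 - s i^2 := by nlinarith [hs0 i, hs1 i]
        have h2 : 0 < 1 - s (i+1)^2 := by nlinarith [hs0 (i+1), hs1 (i+1)]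
        have h3 : s (i+1)^2 ≤ s i^2 := pow_le_pow_left₀ (hs0 _) (hs i hi) 2
        show 2 * s (i+1)^2/(1 - s (i+1)^2) ≤ 2 * s i^2/(1 - s i^2)
        apply div_le_div₀ (by positivity) (by linarith) h1 (by linarith)
      · intro k hk
        rw [Finset.sum_sub_distrib, ← Real.log_prod, ← Real.log_prod, sub_nonpos]
        · apply Real.log_le_log
          · exact Finset.prod_pos fun i hi => hpos i (by have := Finset.mem_range.mp hi; omega)
          · exact h k hk (fun i hi => hpos i (by omega))
        · intro i hi; exact (htpos i (by have := Finset.mem_range.mp hi; omega)).ne'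
        · intro i hi; exact (hpos i (by have := Finset.mem_range.mp hi; omega)).ne'
    · have h0 : s m = 0 := le_antisymm (not_lt.mp hm) (hs0 m)
      rw [Finset.sum_range_succ, Finset.sum_range_succ]
      have h1 := ih (fun i hi => hs i (by omega)) (fun k hk => h k (by omega))
      have h2 : Real.log (1 - t m^2) ≤ 0 := Real.log_nonpos (by nlinarith [ht0 m, ht1 m]) (by nlinarith [ht0 m])
      rw [h0]; simp only [ne_eq, OfNat.ofNat_ne_zero, not_false_eq_true, zero_pow, sub_zero, Real.log_one]
      linarith

lemma nc_major (m : ℕ) (s t : Fin m → ℝ) (hs0 : ∀ i, 0 ≤ s i) (hs1 : ∀ i, s i < 1) (hs : Antitone s)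
    (ht0 : ∀ i, 0 ≤ t i) (ht1 : ∀ i, t i < 1)
    (h : ∀ k, ∀ hk : k ≤ m, (∀ i : Fin k, 0 < s (Fin.castLE hk i)) →
      ∏ i : Fin k, s (Fin.castLE hk i) ≤ ∏ i : Fin k, t (Fin.castLE hk i)) :
    ∑ i, Real.log (1 - t i ^ 2) ≤ ∑ i, Real.log (1 - s i ^ 2) := by
  have ext1 : ∀ (f : Fin m → ℝ), ∃ g : ℕ → ℝ, (∀ i (hi : i < m), g i = f ⟨i, hi⟩) ∧ (∀ i, ¬ i < m → g i = 0) :=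
    fun f => ⟨fun i => if hi : i < m then f ⟨i, hi⟩ else 0, fun i hi => dif_pos hi, fun i hi => dif_neg hi⟩
  obtain ⟨s', hsa, hsb⟩ := ext1 s
  obtain ⟨t', hta, htb⟩ := ext1 t
  have := nc_major_nat m s' t' ?_ ?_ ?_ ?_ ?_ ?_
  · rw [Finset.sum_range, Finset.sum_range] at this
    simpa [hsa, hta] using this
  · intro i; by_cases hi : i < m
    · rw [hsa i hi]; exact hs0 _
    · rw [hsb i hi]
  · intro i; by_cases hi : i < m
    · rw [hsa i hi]; exact hs1 _
    · rw [hsb i hi]; norm_num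
  · intro i hi
    rw [hsa i (by omega), hsa (i+1) hi]; exact hs (by simp)
  · intro i; by_cases hi : i < m
    · rw [hta i hi]; exact ht0 _
    · rw [htb i hi]
  · intro i; by_cases hi : i < m
    · rw [hta i hi]; exact ht1 _
    · rw [htb i hi]; norm_num
  · intro k hk hp
    rw [Finset.prod_range, Finset.prod_range]
    have e1 : ∀ i : Fin k, s' i = s (Fin.castLE hk i) := fun i => hsa i (by omega)
    have e2 : ∀ i : Fin k, t' i = t (Fin.castLE hk i) := fun i => hta i (by omega)
    simp only [e1, e2]
    apply h k hk
    intro i; rw [← e1]; exact hp i i.isLt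

lemma nc_det_gen {ι : Type*} [Fintype ι] [DecidableEq ι] {M : Matrix ι ι ℂ} (hM : M.IsHermitian) (c : ℝ) :
    (1 + (c : ℂ) • M).det = ((∏ i, (1 + c * hM.eigenvalues i) : ℝ) : ℂ) := by
  have hU1 : (hM.eigenvectorUnitary : Matrix ι ι ℂ)ᴴ * (hM.eigenvectorUnitary : Matrix ι ι ℂ) = 1 := by
    have := Unitary.coe_star_mul_self hM.eigenvectorUnitary
    simpa [star_eq_conjTranspose] using this
  have hU2 : (hM.eigenvectorUnitary : Matrix ι ι ℂ) * (hM.eigenvectorUnitary : Matrix ι ι ℂ)ᴴ = 1 :=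
    mul_eq_one_comm.mp hU1
  set U := (hM.eigenvectorUnitary : Matrix ι ι ℂ) with hU
  have hs : M = U * diagonal (fun i => ((hM.eigenvalues i : ℝ) : ℂ)) * Uᴴ := by
    have := hM.spectral_theorem
    rw [Unitary.conjStarAlgAut_apply] at this
    exact this
  have h1 : 1 + (c : ℂ) • M = U * diagonal (fun i => 1 + (c : ℂ) * ((hM.eigenvalues i : ℝ) : ℂ)) * Uᴴ := by
    have : diagonal (fun i => 1 + (c : ℂ) * ((hM.eigenvalues i : ℝ) : ℂ)) = 1 + (c : ℂ) • diagonal (fun i => ((hM.eigenvalues i : ℝ) : ℂ)) := by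
      rw [← diagonal_one, ← diagonal_smul, diagonal_add]; rfl
    rw [this, mul_add, add_mul, mul_one, hU2, Matrix.mul_smul, Matrix.smul_mul, ← hs]
  have h2 : U.det * Uᴴ.det = 1 := by rw [← det_mul, hU2, det_one]
  rw [h1, det_mul, det_mul, det_diagonal]
  push_cast
  linear_combination (∏ i, (1 + (c : ℂ) * (hM.eigenvalues i : ℂ))) * h2

lemma nc_logdet {m n : ℕ} {B : Matrix (Fin m) (Fin m) ℂ} {D : Matrix (Fin n) (Fin n) ℂ}
    {C : Matrix (Fin n) (Fin m) ℂ} (hA : (fromBlocks B Cᴴ C D).PosSemidef)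
    (hB : B.PosSemidef) (hD : D.PosSemidef) {U : Matrix (Fin m) (Fin m) ℂ} (hU2 : U * Uᴴ = 1)
    (σ : Fin m → ℝ) (hσ : Antitone σ) (hCU : Cᴴ * C = U * diagonal (fun i => (σ i : ℂ)) * Uᴴ)
    {α : Fin m ⊕ Fin n → ℝ} {β : Fin m → ℝ} {δ : Fin n → ℝ}
    (hα : ∀ i, 0 ≤ α i) (hβ : ∀ i, 0 ≤ β i) (hδ : ∀ i, 0 ≤ δ i)
    (hdα : (1 + fromBlocks B Cᴴ C D).det = ((∏ i, (1 + α i) : ℝ) : ℂ))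
    (hdβ : (1 + B).det = ((∏ i, (1 + β i) : ℝ) : ℂ))
    (hdδ : (1 + D).det = ((∏ i, (1 + δ i) : ℝ) : ℂ)) :
    ∑ i, Real.log (1 + β i) + ∑ i, Real.log (1 + δ i)
      + ∑ i, Real.log (1 - (√(σ i) / (1 + √(σ i))) ^ 2)
      ≤ ∑ i, Real.log (1 + α i) := by
  have hB1 : (1 + B).PosDef := PosDef.one.add_posSemidef hB
  have hD1 : (1 + D).PosDef := PosDef.one.add_posSemidef hD
  obtain ⟨R, hR, hBR⟩ := nc_factor hB1
  obtain ⟨L, hL, hDL⟩ := nc_factor hD1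
  have hRi : R * R⁻¹ = 1 := mul_nonsing_inv _ hR
  have hLi : L * L⁻¹ = 1 := mul_nonsing_inv _ hL
  have hRi2 : R⁻¹ * R = 1 := nonsing_inv_mul _ hR
  have hLi2 : L⁻¹ * L = 1 := nonsing_inv_mul _ hL
  have hDi : (1 + D)⁻¹ = L⁻¹ * (L⁻¹)ᴴ := by
    rw [hDL, Matrix.mul_inv_rev, conjTranspose_nonsing_inv]
  set Ri := R⁻¹
  set Li := L⁻¹
  have hRi' : Riᴴ * Rᴴ = 1 := by rw [← conjTranspose_mul, hRi, conjTranspose_one]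
  have hLi' : Liᴴ * Lᴴ = 1 := by rw [← conjTranspose_mul, hLi, conjTranspose_one]
  have hRi2' : Rᴴ * Riᴴ = 1 := by rw [← conjTranspose_mul, hRi2, conjTranspose_one]
  set K := Liᴴ * C * Ri with hK
  have hKK : Rᴴ * (Kᴴ * K) * R = Cᴴ * (1 + D)⁻¹ * C := by
    calc _ = (Rᴴ * Riᴴ) * Cᴴ * (Li * Liᴴ) * C * (Ri * R) := by
          rw [hK]; simp only [conjTranspose_mul, conjTranspose_conjTranspose, Matrix.mul_assoc]
      _ = _ := by rw [hRi2', hRi2, hDi, Matrix.one_mul, Matrix.mul_one]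
  have hsch : (1 + B) - Cᴴ * (1 + D)⁻¹ * C = Rᴴ * (1 - Kᴴ * K) * R := by
    rw [Matrix.mul_sub, Matrix.sub_mul, hKK, Matrix.mul_one, ← hBR]
  have h1A : 1 + fromBlocks B Cᴴ C D = fromBlocks (1 + B) Cᴴ C (1 + D) := by
    rw [← fromBlocks_one, fromBlocks_add]; simp
  have hA1 : (fromBlocks (1 + B) Cᴴ C (1 + D)).PosDef := by
    rw [← h1A]; exact PosDef.one.add_posSemidef hA
  have := hD1.isUnit.invertible
  have hdetA : (fromBlocks (1 + B) Cᴴ C (1 + D)).det = (1 + D).det * ((1 + B).det * (1 - Kᴴ * K).det) := by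
    rw [det_fromBlocks₂₂, invOf_eq_nonsing_inv, hsch, hBR]
    simp only [det_mul]; ring
  have hKKh : (Kᴴ * K).PosSemidef := posSemidef_conjTranspose_mul_self K
  obtain ⟨W, e, hW1, hW2, hν, hKW⟩ := nc_spectral hKKh.1
  have hν0 : ∀ i, 0 ≤ (hKKh.1.eigenvalues ∘ e) i := fun i => hKKh.eigenvalues_nonneg _
  set ν := hKKh.1.eigenvalues ∘ e with hνdef
  have hWKW : Wᴴ * (Kᴴ * K) * W = diagonal (fun i => (ν i : ℂ)) := by
    rw [hKW]
    calc _ = (Wᴴ * W) * diagonal (fun i => (ν i : ℂ)) * (Wᴴ * W) := by simp only [Matrix.mul_assoc]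
      _ = _ := by rw [hW1]; simp
  have hdetK : (1 - Kᴴ * K).det = ((∏ i, (1 - ν i) : ℝ) : ℂ) := by
    have h1 := nc_add_diag hW2 (fun i => (ν i : ℂ)) 1 (-1)
    rw [← hKW, one_smul, neg_one_smul, ← sub_eq_add_neg] at h1
    rw [h1, nc_det_diag hW2]
    push_cast
    exact Finset.prod_congr rfl fun _ _ => by ring
  -- ν ≤ 1
  have hν1' : ∀ i, ν i ≤ 1 := by
    have h1 : ((1 + B) - Cᴴ * (1 + D)⁻¹ * C).PosSemidef := by
      have := (PosDef.fromBlocks₂₂ (1 + B) Cᴴ (D := 1 + D) hD1).mp (by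
        rw [conjTranspose_conjTranspose]; exact hA1.posSemidef)
      rwa [conjTranspose_conjTranspose] at this
    have h2 := h1.conjTranspose_mul_mul_same (Ri * W)
    have h3 : (Ri * W)ᴴ * ((1 + B) - Cᴴ * (1 + D)⁻¹ * C) * (Ri * W) = diagonal (fun i => ((1 - ν i : ℝ) : ℂ)) := by
      rw [hsch]
      calc _ = Wᴴ * ((Riᴴ * Rᴴ) * (1 - Kᴴ * K) * (R * Ri)) * W := by
            simp only [conjTranspose_mul, Matrix.mul_assoc]
        _ = _ := by
          rw [hRi, hRi', Matrix.one_mul, Matrix.mul_one, Matrix.mul_sub, Matrix.sub_mul, hWKW, Matrix.mul_one, hW1,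
            ← diagonal_one, diagonal_sub]
          congr 1; ext i; push_cast; rfl
    rw [h3, posSemidef_diagonal_iff] at h2
    intro i
    have := Complex.zero_le_real.mp (h2 i)
    linarith
  have hdetApos := hA1.det_pos
  have hν1 : ∀ i, ν i < 1 := by
    have hne : (1 - Kᴴ * K).det ≠ 0 := by
      intro h0; rw [hdetA, h0] at hdetApos; simp at hdetApos
    rw [hdetK] at hne
    have hne' : ∏ i, (1 - ν i) ≠ 0 := by exact_mod_cast hne
    rw [Finset.prod_ne_zero_iff] at hne'
    intro i
    have := hne' i (Finset.mem_univ _)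
    exact lt_of_le_of_ne (hν1' i) (fun h => this (by rw [h]; ring))
  have hmaj := nc_major m (fun i => √(ν i)) (fun i => √(σ i) / (1 + √(σ i)))
    (fun i => Real.sqrt_nonneg _) (fun i => by rw [Real.sqrt_lt' one_pos]; simpa using hν1 i)
    (fun i j hij => Real.sqrt_le_sqrt (hν hij)) (fun i => by positivity)
    (fun i => by rw [div_lt_one (by positivity)]; linarith) ?_
  · have hsq : ∀ i, √(ν i) ^ 2 = ν i := fun i => Real.sq_sqrt (hν0 i)
    simp only [hsq] at hmaj
    have hdet : (∏ i, (1 + α i)) = (∏ i, (1 + δ i)) * ((∏ i, (1 + β i)) * ∏ i, (1 - ν i)) := by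
      rw [← h1A, hdα, hdδ, hdβ, hdetK] at hdetA
      exact_mod_cast hdetA
    have pA : ∀ i, 1 + α i ≠ 0 := fun i => by have := hα i; positivity
    have pB : ∀ i, 1 + β i ≠ 0 := fun i => by have := hβ i; positivity
    have pD : ∀ i, 1 + δ i ≠ 0 := fun i => by have := hδ i; positivity
    have pν : ∀ i, 1 - ν i ≠ 0 := fun i => by have := hν1 i; intro h; linarith
    have hl := congrArg Real.log hdet
    rw [Real.log_mul (Finset.prod_ne_zero_iff.mpr fun i _ => pD i)
      (mul_ne_zero (Finset.prod_ne_zero_iff.mpr fun i _ => pB i) (Finset.prod_ne_zero_iff.mpr fun i _ => pν i)),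
      Real.log_mul (Finset.prod_ne_zero_iff.mpr fun i _ => pB i) (Finset.prod_ne_zero_iff.mpr fun i _ => pν i),
      Real.log_prod fun i _ => pA i, Real.log_prod fun i _ => pB i, Real.log_prod fun i _ => pD i, Real.log_prod fun i _ => pν i] at hl
    linarith
  · intro k hk hpos
    set s : Fin k → ℝ := fun i => √(ν (Fin.castLE hk i)) with hs
    have hs2 : ∀ i, s i * s i = ν (Fin.castLE hk i) := fun i => Real.mul_self_sqrt (hν0 _)
    set V := W.submatrix id (Fin.castLE hk) with hV
    have hVM : ∀ M : Matrix (Fin m) (Fin m) ℂ, Vᴴ * M * V = (Wᴴ * M * W).submatrix (Fin.castLE hk) (Fin.castLE hk) := by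
      intro M; ext i j; simp [hV, mul_apply]
    have hVV : Vᴴ * V = 1 := by
      have h1 := hVM 1
      rw [Matrix.mul_one, Matrix.mul_one, hW1, submatrix_one _ (Fin.castLE_injective hk)] at h1
      exact h1
    have hVKV : Vᴴ * (Kᴴ * K) * V = diagonal (fun i => ((s i * s i : ℝ) : ℂ)) := by
      rw [hVM, hWKW, submatrix_diagonal _ _ (Fin.castLE_injective hk)]
      congr 1; ext i; simp only [Function.comp]; rw [hs2]
    set Si : Matrix (Fin k) (Fin k) ℂ := diagonal (fun i => (((s i)⁻¹ : ℝ) : ℂ)) with hSi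
    have hSiH : Siᴴ = Si := by
      rw [hSi, diagonal_conjTranspose]; congr 1; ext i; simp
    have hsne : ∀ i, s i ≠ 0 := fun i => (hpos i).ne'
    refine nc_prod hk hA (X := Ri * V) (Y := Li * K * V * Si) ?_ ?_ s hpos ?_ hU2 _ hσ hCU
    · rw [hBR]
      calc _ = Vᴴ * ((Riᴴ * Rᴴ) * (R * Ri)) * V := by simp only [conjTranspose_mul, Matrix.mul_assoc]
        _ = 1 := by rw [hRi, hRi', Matrix.mul_one, Matrix.mul_one, hVV]
    · rw [hDL]
      calc _ = Si * (Vᴴ * (Kᴴ * ((Liᴴ * Lᴴ) * (L * Li)) * K) * V) * Si := by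
            simp only [conjTranspose_mul, hSiH, Matrix.mul_assoc]
        _ = 1 := by
          rw [hLi, hLi', Matrix.mul_one, Matrix.mul_one, hVKV, hSi, diagonal_mul_diagonal, diagonal_mul_diagonal, ← diagonal_one]
          congr 1; ext i
          have := hsne i
          rw [← Complex.ofReal_mul, ← Complex.ofReal_mul, ← Complex.ofReal_one]
          congr 1; field_simp
    · calc _ = Si * (Vᴴ * (Kᴴ * (Liᴴ * C * Ri)) * V) := by
            simp only [conjTranspose_mul, hSiH, Matrix.mul_assoc]
        _ = _ := by
          rw [← hK, hVKV, hSi, diagonal_mul_diagonal]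
          congr 1; ext i
          have := hsne i
          rw [← Complex.ofReal_mul]
          congr 1; field_simp

noncomputable def ncL (x : ℝ) : ℝ := x - Real.log (1 + x)

lemma nc_pointwise {m n : ℕ} {B : Matrix (Fin m) (Fin m) ℂ} {D : Matrix (Fin n) (Fin n) ℂ}
    {C : Matrix (Fin n) (Fin m) ℂ} (hA : (fromBlocks B Cᴴ C D).PosSemidef)
    (hB : B.PosSemidef) (hD : D.PosSemidef) (hC : (Cᴴ * C).PosSemidef)
    (htr : ∑ i, hA.1.eigenvalues i = ∑ i, hB.1.eigenvalues i + ∑ i, hD.1.eigenvalues i)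
    {c : ℝ} (hc : 0 < c) :
    ∑ i, ncL (c * hA.1.eigenvalues i) ≤ ∑ i, ncL (c * hB.1.eigenvalues i) +
      ∑ i, ncL (c * hD.1.eigenvalues i) +
      ∑ i, (ncL (c * (2 * √(hC.1.eigenvalues i))) - 2 * ncL (c * √(hC.1.eigenvalues i))) := by
  obtain ⟨U, e, hU1, hU2, hσ, hCU⟩ := nc_spectral hC.1
  have hc' : (0 : ℂ) ≤ (c : ℂ) := Complex.zero_le_real.mpr hc.le
  have hblk : (c : ℂ) • fromBlocks B Cᴴ C D =
      fromBlocks ((c : ℂ) • B) ((c : ℂ) • C)ᴴ ((c : ℂ) • C) ((c : ℂ) • D) := by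
    rw [fromBlocks_smul, conjTranspose_smul]; simp
  have hcA : (fromBlocks ((c : ℂ) • B) ((c : ℂ) • C)ᴴ ((c : ℂ) • C) ((c : ℂ) • D)).PosSemidef := by
    rw [← hblk]; exact hA.smul hc'
  have h := nc_logdet hcA (hB.smul hc') (hD.smul hc') hU2
    (fun i => c ^ 2 * (hC.1.eigenvalues ∘ e) i)
    (fun i j hij => mul_le_mul_of_nonneg_left (hσ hij) (by positivity)) (by
      have : diagonal (fun i => ((c ^ 2 * (hC.1.eigenvalues ∘ e) i : ℝ) : ℂ)) =
          ((c : ℂ) ^ 2) • diagonal (fun i => (((hC.1.eigenvalues ∘ e) i : ℝ) : ℂ)) := by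
        rw [← diagonal_smul]; congr 1; ext i; simp
      have h5 : U * (((c : ℂ) ^ 2) • diagonal (fun i => (((hC.1.eigenvalues ∘ e) i : ℝ) : ℂ))) * Uᴴ
          = ((c : ℂ) ^ 2) • (Cᴴ * C) := by
        rw [Matrix.mul_smul, Matrix.smul_mul]; exact congrArg _ hCU.symm
      have h6 : ((c : ℂ) • C)ᴴ * ((c : ℂ) • C) = ((c : ℂ) ^ 2) • (Cᴴ * C) := by
        rw [conjTranspose_smul, Matrix.smul_mul, Matrix.mul_smul, smul_smul]
        congr 1; simp [sq]
      rw [h6, ← h5]; exact congrArg (fun z => U * z * Uᴴ) this.symm)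
    (α := fun i => c * hA.1.eigenvalues i) (β := fun i => c * hB.1.eigenvalues i)
    (δ := fun i => c * hD.1.eigenvalues i)
    (fun i => mul_nonneg hc.le (hA.eigenvalues_nonneg i))
    (fun i => mul_nonneg hc.le (hB.eigenvalues_nonneg i))
    (fun i => mul_nonneg hc.le (hD.eigenvalues_nonneg i))
    (by rw [← hblk]; exact nc_det_gen hA.1 c) (nc_det_gen hB.1 c) (nc_det_gen hD.1 c)
  have hl : ∀ s : ℝ, 0 ≤ s → Real.log (1 - (√(c ^ 2 * s) / (1 + √(c ^ 2 * s))) ^ 2) =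
      - (ncL (c * (2 * √s)) - 2 * ncL (c * √s)) := by
    intro s hs
    rw [Real.sqrt_mul (by positivity), Real.sqrt_sq hc.le]
    have hx : 0 ≤ c * √s := by positivity
    have e1 : c * (2 * √s) = 2 * (c * √s) := by ring
    rw [e1]
    generalize c * √s = x at hx
    have e2 : 1 - (x / (1 + x)) ^ 2 = (1 + 2 * x) / (1 + x) ^ 2 := by
      field_simp; ring
    rw [e2, Real.log_div (by positivity) (by positivity), Real.log_pow]
    simp only [ncL]; push_cast; ring
  have h3 : ∑ i, Real.log (1 - (√(c ^ 2 * (hC.1.eigenvalues ∘ e) i) /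
      (1 + √(c ^ 2 * (hC.1.eigenvalues ∘ e) i))) ^ 2) =
      - ∑ i, (ncL (c * (2 * √(hC.1.eigenvalues i))) - 2 * ncL (c * √(hC.1.eigenvalues i))) := by
    rw [← Finset.sum_neg_distrib]
    rw [← Equiv.sum_comp e (fun i => - (ncL (c * (2 * √(hC.1.eigenvalues i))) - 2 * ncL (c * √(hC.1.eigenvalues i))))]
    exact Finset.sum_congr rfl fun i _ => hl _ (hC.eigenvalues_nonneg _)
  beta_reduce at h
  rw [h3] at h
  have hct : ∑ i, c * hA.1.eigenvalues i = ∑ i, c * hB.1.eigenvalues i + ∑ i, c * hD.1.eigenvalues i := by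
    simp only [← Finset.mul_sum]; rw [htr]; ring
  have k1 : ∑ i, ncL (c * hA.1.eigenvalues i) = ∑ i, c * hA.1.eigenvalues i - ∑ i, Real.log (1 + c * hA.1.eigenvalues i) := by
    simp only [ncL]; rw [Finset.sum_sub_distrib]
  have k2 : ∑ i, ncL (c * hB.1.eigenvalues i) = ∑ i, c * hB.1.eigenvalues i - ∑ i, Real.log (1 + c * hB.1.eigenvalues i) := by
    simp only [ncL]; rw [Finset.sum_sub_distrib]
  have k3 : ∑ i, ncL (c * hD.1.eigenvalues i) = ∑ i, c * hD.1.eigenvalues i - ∑ i, Real.log (1 + c * hD.1.eigenvalues i) := by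
    simp only [ncL]; rw [Finset.sum_sub_distrib]
  rw [k1, k2, k3]
  linarith

open MeasureTheory Set in
lemma nc_int_one {q : ℝ} (h1 : 1 < q) (h2 : q < 2) :
    IntegrableOn (fun c : ℝ => c ^ (-q - 1) * ncL c) (Ioi 0) := by
  have hcont : ContinuousOn (fun c : ℝ => c ^ (-q - 1) * ncL c) (Ioi 0) := by
    intro c hc
    have hc : 0 < c := hc
    apply ContinuousAt.continuousWithinAt
    apply ContinuousAt.mul (Real.continuousAt_rpow_const _ _ (Or.inl hc.ne'))
    unfold ncL
    have : (1 + c) ≠ 0 := by positivity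
    fun_prop (disch := assumption)
  have hn : ∀ c : ℝ, 0 < c → 0 ≤ ncL c := by
    intro c hc
    have := Real.log_le_sub_one_of_pos (x := 1 + c) (by positivity)
    unfold ncL; linarith
  rw [← Ioc_union_Ioi_eq_Ioi zero_le_one]
  refine IntegrableOn.union ?_ ?_
  · have hi : IntegrableOn (fun c : ℝ => c ^ (1 - q)) (Ioc 0 1) := by
      rw [← intervalIntegrable_iff_integrableOn_Ioc_of_le zero_le_one]
      exact intervalIntegral.intervalIntegrable_rpow' (by linarith)
    refine Integrable.mono' hi ((hcont.mono Ioc_subset_Ioi_self).aestronglyMeasurable measurableSet_Ioc) ?_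
    refine (ae_restrict_iff' measurableSet_Ioc).mpr (Filter.Eventually.of_forall fun c hc => ?_)
    have hc0 : 0 < c := hc.1
    rw [Real.norm_of_nonneg (mul_nonneg (by positivity) (hn c hc0))]
    have : ncL c ≤ c ^ (2 : ℝ) := by
      have := Real.one_sub_inv_le_log_of_pos (x := 1 + c) (by positivity)
      have h3 : c - c ^ 2 ≤ 1 - (1 + c)⁻¹ := by
        have : 1 - (1 + c)⁻¹ = c / (1 + c) := by field_simp; ring
        rw [this, le_div_iff₀ (by positivity)]
        nlinarith [pow_pos hc0 3]
      rw [Real.rpow_two]; unfold ncL; linarith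
    calc c ^ (-q - 1) * ncL c ≤ c ^ (-q - 1) * c ^ (2 : ℝ) := by gcongr
      _ = c ^ (1 - q) := by rw [← Real.rpow_add hc0]; congr 1; ring
  · have hi : IntegrableOn (fun c : ℝ => c ^ (-q)) (Ioi 1) :=
      integrableOn_Ioi_rpow_of_lt (by linarith) one_pos
    refine Integrable.mono' hi ((hcont.mono (Ioi_subset_Ioi zero_le_one)).aestronglyMeasurable measurableSet_Ioi) ?_
    refine (ae_restrict_iff' measurableSet_Ioi).mpr (Filter.Eventually.of_forall fun c hc => ?_)
    have hc0 : 0 < c := lt_trans one_pos hc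
    rw [Real.norm_of_nonneg (mul_nonneg (by positivity) (hn c hc0))]
    have : ncL c ≤ c ^ (1 : ℝ) := by
      have := Real.log_nonneg (x := 1 + c) (by linarith)
      rw [Real.rpow_one]; unfold ncL; linarith
    calc c ^ (-q - 1) * ncL c ≤ c ^ (-q - 1) * c ^ (1 : ℝ) := by gcongr
      _ = c ^ (-q) := by rw [← Real.rpow_add hc0]; congr 1; ring

open MeasureTheory Set in
lemma nc_kappa_pos {q : ℝ} (h1 : 1 < q) (h2 : q < 2) :
    0 < ∫ c in Ioi (0 : ℝ), c ^ (-q - 1) * ncL c := by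
  have hn : ∀ c : ℝ, 0 < c → 0 < c ^ (-q - 1) * ncL c := by
    intro c hc
    have := Real.log_lt_sub_one_of_pos (x := 1 + c) (by positivity) (by linarith)
    have : 0 < ncL c := by unfold ncL; linarith
    positivity
  rw [setIntegral_pos_iff_support_of_nonneg_ae]
  · have : (Function.support fun c : ℝ => c ^ (-q - 1) * ncL c) ∩ Ioi 0 = Ioi 0 :=
      inter_eq_right.mpr fun c hc => (hn c hc).ne'
    rw [this]; simp
  · exact (ae_restrict_iff' measurableSet_Ioi).mpr (Filter.Eventually.of_forall fun c hc => (hn c hc).le)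
  · exact nc_int_one h1 h2

lemma nc_scale {q x c : ℝ} (hx : 0 < x) (hc : 0 < c) :
    c ^ (-q - 1) * ncL (c * x) = x ^ (q + 1) * ((x * c) ^ (-q - 1) * ncL (x * c)) := by
  rw [Real.mul_rpow hx.le hc.le, mul_comm c x, ← mul_assoc, ← mul_assoc, ← Real.rpow_add hx]
  simp

open MeasureTheory Set in
lemma nc_int {q x : ℝ} (h1 : 1 < q) (h2 : q < 2) (hx : 0 ≤ x) :
    IntegrableOn (fun c : ℝ => c ^ (-q - 1) * ncL (c * x)) (Ioi 0) ∧
    ∫ c in Ioi (0 : ℝ), c ^ (-q - 1) * ncL (c * x) =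
      x ^ q * ∫ c in Ioi (0 : ℝ), c ^ (-q - 1) * ncL c := by
  rcases hx.eq_or_lt with rfl | hx
  · have : q ≠ 0 := by linarith
    simp [ncL, Real.zero_rpow this]
  · have he : EqOn (fun c : ℝ => c ^ (-q - 1) * ncL (c * x))
      (fun c => x ^ (q + 1) * ((x * c) ^ (-q - 1) * ncL (x * c))) (Ioi 0) := fun c hc => nc_scale hx hc
    constructor
    · refine IntegrableOn.congr_fun ?_ he.symm measurableSet_Ioi
      apply Integrable.const_mul
      have := (integrableOn_Ioi_comp_mul_left_iff (fun c : ℝ => c ^ (-q - 1) * ncL c) 0 hx).mpr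
        (by simpa using nc_int_one h1 h2)
      exact this
    · rw [setIntegral_congr_fun measurableSet_Ioi he, integral_const_mul,
        integral_comp_mul_left_Ioi (fun c : ℝ => c ^ (-q - 1) * ncL c) 0 hx, smul_eq_mul, mul_zero,
        ← mul_assoc, Real.rpow_add_one hx.ne']
      congr 1; field_simp

open MeasureTheory Set in
lemma nc_int_sum {ι : Type*} [Fintype ι] {q : ℝ} (h1 : 1 < q) (h2 : q < 2) (f : ι → ℝ) (hf : ∀ i, 0 ≤ f i) :
      IntegrableOn (fun c : ℝ => ∑ i, c ^ (-q - 1) * ncL (c * f i)) (Ioi 0) ∧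
      ∫ c in Ioi (0 : ℝ), ∑ i, c ^ (-q - 1) * ncL (c * f i) =
        (∑ i, f i ^ q) * ∫ c in Ioi (0 : ℝ), c ^ (-q - 1) * ncL c := by
  refine ⟨integrable_finsetSum _ fun i _ => (nc_int h1 h2 (hf i)).1, ?_⟩
  rw [integral_finsetSum _ fun i _ => (nc_int h1 h2 (hf i)).1, Finset.sum_mul]
  exact Finset.sum_congr rfl fun i _ => (nc_int h1 h2 (hf i)).2

open MeasureTheory Set in
lemma nc_integrate {ι₁ ι₂ ι₃ ι₄ : Type*} [Fintype ι₁] [Fintype ι₂] [Fintype ι₃] [Fintype ι₄]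
    {a : ι₁ → ℝ} {b : ι₂ → ℝ} {d : ι₃ → ℝ} {s : ι₄ → ℝ}
    (ha : ∀ i, 0 ≤ a i) (hb : ∀ i, 0 ≤ b i) (hd : ∀ i, 0 ≤ d i) (hs : ∀ i, 0 ≤ s i)
    (h : ∀ c : ℝ, 0 < c → ∑ i, ncL (c * a i) ≤ ∑ i, ncL (c * b i) + ∑ i, ncL (c * d i) +
      ∑ i, (ncL (c * (2 * s i)) - 2 * ncL (c * s i))) {q : ℝ} (h1 : 1 < q) (h2 : q < 2) :
    ∑ i, a i ^ q ≤ ∑ i, b i ^ q + ∑ i, d i ^ q + (2 ^ q - 2) * ∑ i, s i ^ q := by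
  have hκ0 := nc_kappa_pos h1 h2
  have ka := nc_int_sum h1 h2 a ha
  have kb := nc_int_sum h1 h2 b hb
  have kd := nc_int_sum h1 h2 d hd
  have ks := nc_int_sum h1 h2 s hs
  have kt := nc_int_sum h1 h2 (fun i => 2 * s i) (fun i => by have := hs i; positivity)
  set κ := ∫ c in Ioi (0 : ℝ), c ^ (-q - 1) * ncL c with hκ
  have hmono := setIntegral_mono_on ka.1 (((kb.1.add kd.1).add kt.1).add (ks.1.const_mul (-2))) measurableSet_Ioi
    (fun c hc => by
      have hc : 0 < c := hc
      have := mul_le_mul_of_nonneg_left (h c hc) (Real.rpow_nonneg hc.le (-q - 1))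
      simp only [Pi.add_apply, ← Finset.mul_sum]
      rw [Finset.sum_sub_distrib, ← Finset.mul_sum] at this
      linarith)
  rw [integral_add' ((kb.1.add kd.1).add kt.1) (ks.1.const_mul (-2)), integral_add' (kb.1.add kd.1) kt.1,
    integral_add' kb.1 kd.1, integral_const_mul, ka.2, kb.2, kd.2, kt.2, ks.2] at hmono
  have e2 : ∑ i, (2 * s i) ^ q = 2 ^ q * ∑ i, s i ^ q := by
    rw [Finset.mul_sum]
    exact Finset.sum_congr rfl fun i _ => Real.mul_rpow (by norm_num) (hs i)
  rw [e2] at hmono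
  refine le_of_mul_le_mul_right ?_ hκ0
  linarith

lemma nc_closed {ι₁ ι₂ ι₃ ι₄ : Type*} [Fintype ι₁] [Fintype ι₂] [Fintype ι₃] [Fintype ι₄]
    {a : ι₁ → ℝ} {b : ι₂ → ℝ} {d : ι₃ → ℝ} {s : ι₄ → ℝ}
    (h : ∀ q : ℝ, 1 < q → q < 2 →
    ∑ i, a i ^ q ≤ ∑ i, b i ^ q + ∑ i, d i ^ q + (2 ^ q - 2) * ∑ i, s i ^ q) {q : ℝ} (h1 : 1 ≤ q) (h2 : q ≤ 2) :
    ∑ i, a i ^ q ≤ ∑ i, b i ^ q + ∑ i, d i ^ q + (2 ^ q - 2) * ∑ i, s i ^ q := by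
  have hc : closure (Set.Ioo (1 : ℝ) 2) = Set.Icc 1 2 := closure_Ioo (by norm_num)
  have hp : ∀ x : ℝ, ContinuousOn (fun q : ℝ => x ^ q) (Set.Icc 1 2) := fun x q hq =>
    (Real.continuousAt_const_rpow' (by have := hq.1; linarith)).continuousWithinAt
  have := le_on_closure (s := Set.Ioo (1 : ℝ) 2) (f := fun q => ∑ i, a i ^ q)
    (g := fun q => ∑ i, b i ^ q + ∑ i, d i ^ q + (2 ^ q - 2) * ∑ i, s i ^ q)
    (fun q hq => h q hq.1 hq.2)
    (by rw [hc]; exact continuousOn_finsetSum _ fun i _ => hp _)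
    (by
      rw [hc]
      exact ((continuousOn_finsetSum _ fun i _ => hp _).add (continuousOn_finsetSum _ fun i _ => hp _)).add
        (((hp 2).sub continuousOn_const).mul (continuousOn_finsetSum _ fun i _ => hp _)))
    (x := q) (by rw [hc]; exact ⟨h1, h2⟩)
  exact this

lemma nc_trace {ι : Type*} [Fintype ι] [DecidableEq ι] {M : Matrix ι ι ℂ} (hM : M.IsHermitian) (q : ℝ) :
    (matrixRpow M q).trace = ((∑ i, hM.eigenvalues i ^ q : ℝ) : ℂ) := by
  unfold matrixRpow
  rw [hM.cfc_eq, IsHermitian.cfc, Unitary.conjStarAlgAut_apply, trace_mul_cycle, Unitary.coe_star_mul_self,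
    Matrix.one_mul, trace_diagonal]
  simp

theorem norm_compression_inequality {m n : ℕ}
    (B : Matrix (Fin m) (Fin m) ℂ) (D : Matrix (Fin n) (Fin n) ℂ)
    (C : Matrix (Fin n) (Fin m) ℂ)
    (hA : (Matrix.fromBlocks B Cᴴ C D).PosSemidef)
    (q : ℝ) (hq : 1 ≤ q ∧ q ≤ 2) :
    (matrixRpow (Matrix.fromBlocks B Cᴴ C D) q).trace ≤
      ((2 ^ q - 2 : ℝ) : ℂ) * (matrixRpow (Cᴴ * C) (q / 2)).trace +
        (matrixRpow B q).trace + (matrixRpow D q).trace := by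
  have hB : B.PosSemidef := by
    have := hA.submatrix (Sum.inl : Fin m → Fin m ⊕ Fin n)
    exact this
  have hD : D.PosSemidef := by
    have := hA.submatrix (Sum.inr : Fin n → Fin m ⊕ Fin n)
    exact this
  have hC : (Cᴴ * C).PosSemidef := posSemidef_conjTranspose_mul_self C
  have htr : ∑ i, hA.1.eigenvalues i = ∑ i, hB.1.eigenvalues i + ∑ i, hD.1.eigenvalues i := by
    have h1 := hA.1.trace_eq_sum_eigenvalues
    have h2 := hB.1.trace_eq_sum_eigenvalues
    have h3 := hD.1.trace_eq_sum_eigenvalues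
    have h0 : (fromBlocks B Cᴴ C D).trace = B.trace + D.trace := by
      simp [Matrix.trace]
    rw [h0, h2, h3] at h1
    simp only [Complex.coe_algebraMap, RCLike.ofReal_eq_complex_ofReal] at h1
    exact_mod_cast h1.symm
  have key := nc_closed (fun q h1 h2 => nc_integrate (fun i => hA.eigenvalues_nonneg i)
    (fun i => hB.eigenvalues_nonneg i) (fun i => hD.eigenvalues_nonneg i)
    (fun i => Real.sqrt_nonneg (hC.1.eigenvalues i))
    (fun c hc => nc_pointwise hA hB hD hC htr hc) h1 h2) hq.1 hq.2
  rw [nc_trace hA.1, nc_trace hB.1, nc_trace hD.1, nc_trace hC.1]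
  have hs : ∑ i, hC.1.eigenvalues i ^ (q / 2) = ∑ i, √(hC.1.eigenvalues i) ^ q := by
    refine Finset.sum_congr rfl fun i _ => ?_
    rw [Real.sqrt_eq_rpow, ← Real.rpow_mul (hC.eigenvalues_nonneg i)]
    congr 1; ring
  rw [hs]
  have : ∑ i, hA.1.eigenvalues i ^ q ≤ (2 ^ q - 2) * ∑ i, √(hC.1.eigenvalues i) ^ q +
      ∑ i, hB.1.eigenvalues i ^ q + ∑ i, hD.1.eigenvalues i ^ q := by linarith
  exact_mod_cast Complex.real_le_real.mpr this
end

section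
/- Let B be an m×m complex matrix, D an n×n complex matrix, C an n×m complex matrix, and suppose the block matrix A = [[B, Cᴴ],[C, D]] (of size (m+n)×(m+n)) is positive semidefinite. Then for every real q with 0 < q ≤ 1 or 2 ≤ q ≤ 3, Tr(A^q) ≥ (2^q - 2)·Tr((CᴴC)^{q/2}) + Tr(B^q) + Tr(D^q). -/
open ComplexOrder Matrix

set_option linter.unusedSimpArgs false

theorem nci_diag {ι : Type*} [Fintype ι] [DecidableEq ι] {M : Matrix ι ι ℂ} (hM : M.IsHermitian) :
    ∃ U : Matrix ι ι ℂ, Uᴴ * U = 1 ∧ U * Uᴴ = 1 ∧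
      M = U * diagonal (fun i => (hM.eigenvalues i : ℂ)) * Uᴴ := by
  refine ⟨hM.eigenvectorUnitary, ?_, ?_, ?_⟩
  · rw [← star_eq_conjTranspose]; exact Unitary.coe_star_mul_self _
  · rw [← star_eq_conjTranspose]; exact Unitary.coe_mul_star_self _
  · have := hM.spectral_theorem
    rw [Unitary.conjStarAlgAut_apply] at this
    exact this

theorem nci_trace_cfc {ι : Type*} [Fintype ι] [DecidableEq ι] {M : Matrix ι ι ℂ}
    (hM : M.IsHermitian) (f : ℝ → ℝ) :
    (cfc f M).trace = ((∑ i, f (hM.eigenvalues i) : ℝ) : ℂ) := by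
  rw [hM.cfc_eq, Matrix.IsHermitian.cfc, Unitary.conjStarAlgAut_apply, Matrix.trace_mul_comm,
    ← mul_assoc, Unitary.coe_star_mul_self, one_mul, trace_diagonal]
  simp

theorem nci_diag_sorted {k : ℕ} {M : Matrix (Fin k) (Fin k) ℂ} (hM : M.IsHermitian) :
    ∃ (U : Matrix (Fin k) (Fin k) ℂ) (e : Equiv.Perm (Fin k)), Uᴴ * U = 1 ∧ U * Uᴴ = 1 ∧
      Antitone (fun i => hM.eigenvalues (e i)) ∧
      M = U * diagonal (fun i => (hM.eigenvalues (e i) : ℂ)) * Uᴴ := by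
  obtain ⟨U, h1, h2, h3⟩ := nci_diag hM
  have hs := Tuple.monotone_sort (fun i => - hM.eigenvalues i)
  set e := Tuple.sort (fun i => - hM.eigenvalues i)
  refine ⟨U.submatrix id e, e, ?_, ?_, ?_, ?_⟩
  · ext i j
    have := congrFun (congrFun h1 (e i)) (e j)
    simpa [mul_apply, Matrix.one_apply] using this
  · ext i j
    have := congrFun (congrFun h2 i) j
    rw [← this]
    simp only [mul_apply, conjTranspose_apply, submatrix_apply, id]
    exact Equiv.sum_comp e (fun x => U i x * star (U j x))
  · intro i j hij
    have := hs hij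
    simpa using this
  · conv_lhs => rw [h3]
    ext i j
    rw [mul_apply, mul_apply]
    simp only [mul_diagonal, conjTranspose_apply, submatrix_apply, id]
    exact (Equiv.sum_comp e (fun x => U i x * (hM.eigenvalues x : ℂ) * star (U j x))).symm

theorem nci_sqrt {ι : Type*} [Fintype ι] [DecidableEq ι] {M : Matrix ι ι ℂ} (hM : M.PosSemidef) :
    ∃ S : Matrix ι ι ℂ, S.PosSemidef ∧ S * S = M := by
  obtain ⟨U, h1, h2, h3⟩ := nci_diag hM.isHermitian
  refine ⟨U * diagonal (fun i => ((Real.sqrt (hM.isHermitian.eigenvalues i) : ℝ) : ℂ)) * Uᴴ, ?_, ?_⟩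
  · refine PosSemidef.mul_mul_conjTranspose_same (posSemidef_diagonal_iff.mpr fun i => ?_) U
    exact_mod_cast Real.sqrt_nonneg _
  · conv_rhs => rw [h3]
    calc _ = U * diagonal (fun i => ((Real.sqrt (hM.isHermitian.eigenvalues i) : ℝ) : ℂ)) * (Uᴴ * U)
          * diagonal (fun i => ((Real.sqrt (hM.isHermitian.eigenvalues i) : ℝ) : ℂ)) * Uᴴ := by
            simp only [mul_assoc]
      _ = _ := by
        rw [h1, mul_one, mul_assoc U, diagonal_mul_diagonal]
        congr 3
        ext i
        rw [← Complex.ofReal_mul, Real.mul_self_sqrt (hM.eigenvalues_nonneg i)]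

theorem nci_det_contr {k : ℕ} {K : Matrix (Fin k) (Fin k) ℂ} (h : (1 - Kᴴ * K).PosSemidef) :
    ‖K.det‖ ≤ 1 := by
  have hP := posSemidef_conjTranspose_mul_self K
  obtain ⟨U, h1, h2, h3⟩ := nci_diag hP.isHermitian
  have hle : ∀ i, hP.isHermitian.eigenvalues i ≤ 1 := by
    intro i
    have h4 := h.conjTranspose_mul_mul_same U
    rw [h3] at h4
    have e : Uᴴ * (1 - U * diagonal (fun i => (hP.isHermitian.eigenvalues i : ℂ)) * Uᴴ) * U
        = 1 - diagonal (fun i => (hP.isHermitian.eigenvalues i : ℂ)) := by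
      calc _ = Uᴴ * U - (Uᴴ * U) * diagonal (fun i => (hP.isHermitian.eigenvalues i : ℂ)) * (Uᴴ * U) := by
            simp only [mul_sub, sub_mul, mul_assoc, mul_one]
        _ = _ := by simp [h1]
    rw [e] at h4
    have := h4.diag_nonneg (i := i)
    simp only [Matrix.sub_apply, one_apply_eq, diagonal_apply_eq] at this
    rw [sub_nonneg] at this
    exact_mod_cast this
  have hd := hP.isHermitian.det_eq_prod_eigenvalues
  rw [det_mul, det_conjTranspose] at hd
  have hn : ‖K.det‖ * ‖K.det‖ = ∏ i, hP.isHermitian.eigenvalues i := by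
    have := congrArg norm hd
    rw [norm_mul, norm_star] at this
    rw [this, norm_prod]
    refine Finset.prod_congr rfl (fun i _ => ?_)
    simp [abs_of_nonneg (hP.eigenvalues_nonneg i)]
  have : ∏ i, hP.isHermitian.eigenvalues i ≤ 1 :=
    Finset.prod_le_one (fun i _ => hP.eigenvalues_nonneg i) (fun i _ => hle i)
  nlinarith [norm_nonneg K.det]

theorem nci_contr' {a b k l : Type*} [Fintype a] [Fintype b] [Fintype k] [Fintype l] [DecidableEq l]
    (P1 : Matrix a k ℂ) (Q1 : Matrix a l ℂ) (P2 : Matrix b k ℂ) (Q2 : Matrix b l ℂ)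
    (hQ : Q1ᴴ * Q1 + Q2ᴴ * Q2 = 1) (K : Matrix l k ℂ)
    (hK : K = Q1ᴴ * P1 + Q2ᴴ * P2) : (P1ᴴ * P1 + P2ᴴ * P2 - Kᴴ * K).PosSemidef := by
  have e : P1ᴴ * P1 + P2ᴴ * P2 - Kᴴ * K
      = (P1 - Q1 * K)ᴴ * (P1 - Q1 * K) + (P2 - Q2 * K)ᴴ * (P2 - Q2 * K) := by
    have hKh : Kᴴ = P1ᴴ * Q1 + P2ᴴ * Q2 := by rw [hK]; simp
    calc P1ᴴ * P1 + P2ᴴ * P2 - Kᴴ * K = (P1ᴴ * P1 + P2ᴴ * P2) - (P1ᴴ * Q1 + P2ᴴ * Q2) * K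
          - Kᴴ * (Q1ᴴ * P1 + Q2ᴴ * P2) + Kᴴ * (Q1ᴴ * Q1 + Q2ᴴ * Q2) * K := by
            rw [hQ, ← hK, ← hKh]; simp
      _ = _ := by
        simp only [conjTranspose_sub, conjTranspose_mul]
        simp only [Matrix.mul_add, Matrix.add_mul, Matrix.mul_sub, Matrix.sub_mul, Matrix.mul_assoc]
        abel
  rw [e]
  exact (posSemidef_conjTranspose_mul_self _).add (posSemidef_conjTranspose_mul_self _)

theorem nci_contr {a b k : Type*} [Fintype a] [Fintype b] [Fintype k] [DecidableEq k]
    (P1 Q1 : Matrix a k ℂ) (P2 Q2 : Matrix b k ℂ)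
    (hP : P1ᴴ * P1 + P2ᴴ * P2 = 1) (hQ : Q1ᴴ * Q1 + Q2ᴴ * Q2 = 1) (K : Matrix k k ℂ)
    (hK : K = Q1ᴴ * P1 + Q2ᴴ * P2) : (1 - Kᴴ * K).PosSemidef := by
  rw [← hP]; exact nci_contr' P1 Q1 P2 Q2 hQ K hK

theorem nci_inj {a k : Type*} [Fintype a] [Fintype k] [DecidableEq k]
    (X : Matrix a k ℂ) (Y : Matrix k a ℂ) (L : Matrix k k ℂ) (h : (Y * X).det ≠ 0)
    (hL : L * L = Xᴴ * X) : L.det ≠ 0 := by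
  intro h0
  obtain ⟨v, hv, hv0⟩ := Matrix.exists_mulVec_eq_zero_iff.mpr h0
  have h1 : (Xᴴ * X) *ᵥ v = 0 := by rw [← hL, ← mulVec_mulVec, hv0, mulVec_zero]
  rw [conjTranspose_mul_self_mulVec_eq_zero] at h1
  exact h (Matrix.exists_mulVec_eq_zero_iff.mp ⟨v, hv, by rw [← mulVec_mulVec, h1, mulVec_zero]⟩)

theorem nci_core {m n k : ℕ} {N : Type*} [Fintype N]
    (Z1 : Matrix N (Fin m) ℂ) (Z2 : Matrix N (Fin n) ℂ) (C : Matrix (Fin n) (Fin m) ℂ)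
    (hC : C = Z2ᴴ * Z1)
    (X : Matrix (Fin m) (Fin k) ℂ) (Y : Matrix (Fin n) (Fin k) ℂ)
    (hX : (Z1 * X)ᴴ * (Z1 * X) + Xᴴ * X = 1) (hY : (Z2 * Y)ᴴ * (Z2 * Y) + Yᴴ * Y = 1)
    (hdet : (Yᴴ * C * X).det ≠ 0) :
    ∃ (O : Matrix (Fin m) (Fin k) ℂ) (R : Matrix (Fin k) (Fin k) ℂ), Oᴴ * O = 1 ∧
      R.PosSemidef ∧ R * R = Oᴴ * (Cᴴ * C) * O ∧ 
      ‖(Yᴴ * C * X).det‖ * ‖(1 + R).det‖ ≤ ‖R.det‖ := by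
  obtain ⟨L, hL, hLL⟩ := nci_sqrt (posSemidef_conjTranspose_mul_self X)
  have hLd : L.det ≠ 0 := nci_inj X (Yᴴ * C) L hdet hLL
  have hLu : IsUnit L.det := isUnit_iff_ne_zero.mpr hLd
  set O := X * L⁻¹ with hO
  have hXO : X = O * L := by rw [hO, Matrix.mul_assoc, nonsing_inv_mul _ hLu, Matrix.mul_one]
  have hLh : Lᴴ = L := hL.isHermitian
  have hOO : Oᴴ * O = 1 := by
    rw [hO, conjTranspose_mul, conjTranspose_nonsing_inv, hLh]
    calc _ = L⁻¹ * (Xᴴ * X) * L⁻¹ := by simp only [Matrix.mul_assoc]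
      _ = _ := by
        rw [← hLL, ← Matrix.mul_assoc, nonsing_inv_mul _ hLu, Matrix.one_mul, mul_nonsing_inv _ hLu]
  obtain ⟨R, hR, hRR⟩ := nci_sqrt (posSemidef_conjTranspose_mul_self (C * O))
  have hdet2 : (Yᴴ * C * X).det = (Yᴴ * (C * O)).det * L.det := by
    rw [← det_mul, hXO]; simp only [Matrix.mul_assoc]
  have hRd : R.det ≠ 0 := nci_inj (C * O) Yᴴ R (fun h => hdet (by rw [hdet2, h, zero_mul])) hRR
  have hRu : IsUnit R.det := isUnit_iff_ne_zero.mpr hRd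
  have hRh : Rᴴ = R := hR.isHermitian
  set U := C * O * R⁻¹ with hU
  have hUU : Uᴴ * U = 1 := by
    rw [hU, conjTranspose_mul, conjTranspose_nonsing_inv, hRh]
    calc _ = R⁻¹ * ((C * O)ᴴ * (C * O)) * R⁻¹ := by simp only [Matrix.mul_assoc]
      _ = _ := by
        rw [← hRR, ← Matrix.mul_assoc, nonsing_inv_mul _ hRu, Matrix.one_mul, mul_nonsing_inv _ hRu]
  have hV : (Z1 * X)ᴴ * (Z1 * X) + (U * L)ᴴ * (U * L) = 1 := by
    rw [← hX]
    congr 1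
    calc (U * L)ᴴ * (U * L) = Lᴴ * (Uᴴ * U) * L := by
          simp only [conjTranspose_mul, Matrix.mul_assoc]
      _ = _ := by rw [hUU, hLh, Matrix.mul_one, hLL]
  have hK := nci_det_contr (nci_contr (Z1 * X) (Z2 * Y) (U * L) Y hV hY _ rfl)
  have hKe : (Z2 * Y)ᴴ * (Z1 * X) + Yᴴ * (U * L) = Yᴴ * (C * O) * ((1 + R) * R⁻¹) * L := by
    have e1 : (1 + R) * R⁻¹ = R⁻¹ + 1 := by
      rw [Matrix.add_mul, Matrix.one_mul, mul_nonsing_inv _ hRu]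
    have e2 : (Z2 * Y)ᴴ * (Z1 * X) = Yᴴ * (C * O) * L := by
      rw [hC, hXO]; simp only [conjTranspose_mul, Matrix.mul_assoc]
    rw [e1, e2, hU]
    simp only [Matrix.mul_add, Matrix.add_mul, Matrix.mul_assoc, Matrix.one_mul, Matrix.mul_one]
    abel
  refine ⟨O, R, hOO, hR, ?_, ?_⟩
  · rw [hRR]; simp only [conjTranspose_mul, Matrix.mul_assoc]
  · rw [hKe] at hK
    simp only [det_mul, norm_mul] at hK
    rw [hdet2, norm_mul]
    have hinv : ‖(R⁻¹).det‖ * ‖R.det‖ = 1 := by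
      rw [← norm_mul, ← det_mul, nonsing_inv_mul _ hRu]; simp
    calc _ = ‖(Yᴴ * (C * O)).det‖ * ‖L.det‖ * ‖(1 + R).det‖ * (‖(R⁻¹).det‖ * ‖R.det‖) := by
          rw [hinv]; simp only [det_mul, norm_mul, mul_one]
      _ = (‖(Yᴴ * (C * O)).det‖ * (‖(1 + R).det‖ * ‖(R⁻¹).det‖) * ‖L.det‖) * ‖R.det‖ := by ring
      _ ≤ 1 * ‖R.det‖ := by
        refine mul_le_mul_of_nonneg_right ?_ (norm_nonneg _)
        simpa only [det_mul, norm_mul] using hK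
      _ = _ := one_mul _

theorem nci_quad {m k : ℕ} (E : Matrix (Fin m) (Fin k) ℂ) (d : Fin m → ℝ) (ν : Fin k → ℝ)
    (h : Eᴴ * diagonal (fun i => (d i : ℂ)) * E = diagonal (fun i => (ν i : ℂ))) (c : Fin k → ℂ) :
    ∑ a, d a * Complex.normSq ((E *ᵥ c) a) = ∑ b, ν b * Complex.normSq (c b) := by
  have h1 : star c ⬝ᵥ (Eᴴ * diagonal (fun i => (d i : ℂ)) * E) *ᵥ c
      = star (E *ᵥ c) ⬝ᵥ (diagonal (fun i => (d i : ℂ))) *ᵥ (E *ᵥ c) := by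
    rw [star_mulVec, ← mulVec_mulVec, ← mulVec_mulVec, dotProduct_mulVec]
  rw [h] at h1
  simp only [dotProduct, mulVec_diagonal, Pi.star_apply, RCLike.star_def] at h1
  have e : ∀ (r : ℝ) (z : ℂ), (starRingEnd ℂ) z * ((r : ℂ) * z) = ((r * Complex.normSq z : ℝ) : ℂ) := by
    intro r z
    rw [Complex.ofReal_mul, ← Complex.mul_conj]; ring
  simp only [e] at h1
  exact_mod_cast h1.symm

theorem nci_interlace {m k : ℕ} (hk : k ≤ m) (E : Matrix (Fin m) (Fin k) ℂ)
    (μ : Fin m → ℝ) (ν : Fin k → ℝ) (hμ : Antitone μ) (hν : Antitone ν) (hE : Eᴴ * E = 1)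
    (h : Eᴴ * diagonal (fun i => (μ i : ℂ)) * E = diagonal (fun i => (ν i : ℂ))) (j : Fin k) :
    ν j ≤ μ (Fin.castLE hk j) := by
  let f : (Fin (j+1) → ℂ) →ₗ[ℂ] (Fin j → ℂ) := Matrix.toLin' (Matrix.of fun (a : Fin j) (b : Fin (j+1)) =>
    E ⟨a, by omega⟩ ⟨b, by omega⟩)
  have hker : f.ker ≠ ⊥ := LinearMap.ker_ne_bot_of_finrank_lt (by simp)
  obtain ⟨c, hc, hc0⟩ := (Submodule.ne_bot_iff _).mp hker
  rw [LinearMap.mem_ker] at hc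
  set c' : Fin k → ℂ := fun b => if hb : (b : ℕ) < j + 1 then c ⟨b, hb⟩ else 0 with hc'
  have hv0 : ∀ a : Fin m, (a : ℕ) < j → (E *ᵥ c') a = 0 := by
    intro a ha
    have h1 := congrFun hc ⟨a, ha⟩
    simp only [f, toLin'_apply, mulVec, dotProduct, of_apply, Pi.zero_apply] at h1
    rw [← h1]
    simp only [mulVec, dotProduct]
    symm
    refine Finset.sum_of_injOn (fun b : Fin (j+1) => (⟨b, by omega⟩ : Fin k)) ?_ ?_ ?_ ?_
    · intro x _ y _ hxy; simpa [Fin.ext_iff] using hxy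
    · intro x _; simp
    · intro b _ hb
      have : ¬ ((b : ℕ) < j + 1) := fun hlt => hb ⟨⟨b, hlt⟩, by simp, by simp⟩
      simp only [hc', this, dif_neg, not_false_eq_true, mul_zero]
    · intro b _
      have : (b : ℕ) < j + 1 := b.2
      simp only [hc', this, dif_pos]
  have hq := nci_quad E μ ν h c'
  have hq1 := nci_quad E (fun _ => 1) (fun _ => 1) (by simpa using hE) c'
  simp only [one_mul] at hq1
  have hpos : 0 < ∑ b, Complex.normSq (c' b) := by
    obtain ⟨i, hi⟩ := Function.ne_iff.mp hc0
    refine Finset.sum_pos' (fun b _ => Complex.normSq_nonneg _) ⟨⟨i, by omega⟩, Finset.mem_univ _, ?_⟩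
    have : (i : ℕ) < j + 1 := i.2
    simp only [hc', this, dif_pos]
    exact Complex.normSq_pos.mpr hi
  have hup : ∑ a, μ a * Complex.normSq ((E *ᵥ c') a) ≤
      μ (Fin.castLE hk j) * ∑ a, Complex.normSq ((E *ᵥ c') a) := by
    rw [Finset.mul_sum]
    refine Finset.sum_le_sum (fun a _ => ?_)
    by_cases ha : (a : ℕ) < j
    · rw [hv0 a ha]; simp
    · exact mul_le_mul_of_nonneg_right (hμ (by simpa [Fin.le_def] using ha)) (Complex.normSq_nonneg _)
  have hlo : ν j * ∑ b, Complex.normSq (c' b) ≤ ∑ b, ν b * Complex.normSq (c' b) := by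
    rw [Finset.mul_sum]
    refine Finset.sum_le_sum (fun b _ => ?_)
    by_cases hb : (b : ℕ) < j + 1
    · exact mul_le_mul_of_nonneg_right (hν (by rw [Fin.le_def]; omega)) (Complex.normSq_nonneg _)
    · simp only [hc', hb, dif_neg, not_false_eq_true, Complex.normSq_zero, mul_zero, le_refl]
  rw [hq1] at hup
  rw [hq] at hup
  exact le_of_mul_le_mul_right (hlo.trans hup) hpos

theorem nci_abel (w d : ℕ → ℝ) (K : ℕ) (hw : ∀ i, i < K → 0 ≤ w i)
    (hanti : ∀ i, i + 1 < K → w (i+1) ≤ w i)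
    (hS : ∀ k, k ≤ K → 0 ≤ ∑ i ∈ Finset.range k, d i) :
    0 ≤ ∑ i ∈ Finset.range K, w i * d i := by
  have key : ∀ k, k + 1 ≤ K →
      w k * ∑ i ∈ Finset.range (k+1), d i ≤ ∑ i ∈ Finset.range (k+1), w i * d i := by
    intro k
    induction k with
    | zero => intro _; simp
    | succ k ih =>
      intro hk
      rw [Finset.sum_range_succ, Finset.sum_range_succ (fun i => w i * d i)]
      have h1 := ih (by omega)
      have h2 := hanti k (by omega)
      have h3 := hS (k+1) (by omega)
      nlinarith [mul_le_mul_of_nonneg_right h2 h3]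
  cases K with
  | zero => simp
  | succ k =>
    exact le_trans (mul_nonneg (hw k (by omega)) (hS (k+1) le_rfl)) (key k le_rfl)

theorem nci_tangent {x y : ℝ} (hx : 0 < x) (hx1 : x < 1) (hy : 0 < y) (hy1 : y < 1) :
    x / (1 - x) * (Real.log y - Real.log x) ≤ Real.log (1 - x) - Real.log (1 - y) := by
  have h1 : Real.log (y / x) ≤ y / x - 1 := Real.log_le_sub_one_of_pos (by positivity)
  have h2 : Real.log ((1 - y) / (1 - x)) ≤ (1 - y) / (1 - x) - 1 :=
    Real.log_le_sub_one_of_pos (div_pos (by linarith) (by linarith))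
  rw [Real.log_div hy.ne' hx.ne'] at h1
  rw [Real.log_div (by linarith) (by linarith)] at h2
  have hx' : 0 < 1 - x := by linarith
  have h3 : x * (Real.log y - Real.log x) ≤ y - x := by
    have := mul_le_mul_of_nonneg_left h1 hx.le
    have e : x * (y / x - 1) = y - x := by field_simp
    linarith
  have h4 : (1 - x) * (Real.log (1-y) - Real.log (1-x)) ≤ x - y := by
    have := mul_le_mul_of_nonneg_left h2 hx'.le
    have e : (1 - x) * ((1 - y) / (1 - x) - 1) = x - y := by field_simp; ring
    linarith
  rw [div_mul_eq_mul_div, div_le_iff₀ hx']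
  nlinarith

/-- majorization step -/
theorem nci_major {m : ℕ} (x y : Fin m → ℝ) (hx : Antitone x) (hx0 : ∀ i, 0 ≤ x i)
    (hx1 : ∀ i, x i < 1) (hy0 : ∀ i, 0 ≤ y i) (hy1 : ∀ i, y i < 1)
    (h : ∀ (k : ℕ) (hk : k ≤ m), (∀ i : Fin k, 0 < x (Fin.castLE hk i)) →
      ∏ i : Fin k, x (Fin.castLE hk i) ≤ ∏ i : Fin k, y (Fin.castLE hk i)) :
    ∑ i, Real.log (1 - y i) ≤ ∑ i, Real.log (1 - x i) := by
  classical
  -- sequences on ℕ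
  set X : ℕ → ℝ := fun i => if hi : i < m then x ⟨i, hi⟩ else 0 with hX
  set Y : ℕ → ℝ := fun i => if hi : i < m then y ⟨i, hi⟩ else 0 with hY
  have hXv : ∀ i : Fin m, X i = x i := by intro i; simp [hX]
  have hYv : ∀ i : Fin m, Y i = y i := by intro i; simp [hY]
  have hX0 : ∀ i, 0 ≤ X i := by intro i; simp only [hX]; split_ifs <;> simp [hx0]
  have hX1 : ∀ i, X i < 1 := by intro i; simp only [hX]; split_ifs <;> simp [hx1]
  have hY0 : ∀ i, 0 ≤ Y i := by intro i; simp only [hY]; split_ifs <;> simp [hy0]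
  have hY1 : ∀ i, Y i < 1 := by intro i; simp only [hY]; split_ifs <;> simp [hy1]
  have hXm : ∀ i, m ≤ i → X i = 0 := by intro i hi; simp [hX, not_lt.mpr hi]
  have hXa : Antitone X := by
    intro i j hij
    by_cases hj : j < m
    · have hi : i < m := lt_of_le_of_lt hij hj
      simp only [hX, hi, hj, dif_pos]
      exact hx (by simpa using hij)
    · rw [hXm j (not_lt.mp hj)]; exact hX0 i
  have hex : ∃ K, X K = 0 := ⟨m, hXm m le_rfl⟩
  set K := Nat.find hex with hK
  have hK0 : X K = 0 := Nat.find_spec hex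
  have hKm : K ≤ m := Nat.find_min' hex (hXm m le_rfl)
  have hKpos : ∀ i, i < K → 0 < X i := fun i hi =>
    lt_of_le_of_ne (hX0 i) (Ne.symm (Nat.find_min hex hi))
  have hprod : ∀ k, k ≤ K → ∏ i ∈ Finset.range k, X i ≤ ∏ i ∈ Finset.range k, Y i := by
    intro k hk
    have hkm := hk.trans hKm
    have := h k hkm (fun i => by
      rw [← hXv]; exact hKpos _ (lt_of_lt_of_le (by simp) hk))
    rw [← Fin.prod_univ_eq_prod_range, ← Fin.prod_univ_eq_prod_range]
    calc _ = _ := Finset.prod_congr rfl (fun i _ => by rw [← hXv]; rfl)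
      _ ≤ _ := this
      _ = _ := Finset.prod_congr rfl (fun i _ => by rw [← hYv]; rfl)
  have hXprod : ∀ k, k ≤ K → 0 < ∏ i ∈ Finset.range k, X i := fun k hk =>
    Finset.prod_pos (fun i hi => hKpos i (lt_of_lt_of_le (Finset.mem_range.mp hi) hk))
  have hYpos : ∀ i, i < K → 0 < Y i := by
    intro i hi
    have h1 := lt_of_lt_of_le (hXprod (i+1) hi) (hprod (i+1) hi)
    refine lt_of_le_of_ne (hY0 i) (fun h0 => ?_)
    rw [Finset.prod_range_succ, ← h0, mul_zero] at h1
    exact lt_irrefl _ h1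
  have hab := nci_abel (fun i => X i / (1 - X i)) (fun i => Real.log (Y i) - Real.log (X i)) K
    (fun i _ => div_nonneg (hX0 i) (by linarith [hX1 i]))
    (fun i _ => by
      have h1 := hX1 i; have h2 := hX1 (i+1)
      have h3 := hXa (Nat.le_succ i)
      simp only [Nat.succ_eq_add_one] at h3
      show X (i+1) / (1 - X (i+1)) ≤ X i / (1 - X i)
      rw [div_le_div_iff₀ (by linarith) (by linarith)]
      nlinarith)
    (fun k hk => by
      rw [Finset.sum_sub_distrib, ← Real.log_prod (fun i hi => (hYpos i (lt_of_lt_of_le (Finset.mem_range.mp hi) hk)).ne'),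
        ← Real.log_prod (fun i hi => (hKpos i (lt_of_lt_of_le (Finset.mem_range.mp hi) hk)).ne')]
      have := Real.log_le_log (hXprod k hk) (hprod k hk)
      linarith)
  have h1 : ∑ i ∈ Finset.range K, Real.log (1 - Y i) ≤ ∑ i ∈ Finset.range K, Real.log (1 - X i) := by
    rw [← sub_nonneg, ← Finset.sum_sub_distrib]
    refine hab.trans (Finset.sum_le_sum (fun i hi => ?_))
    have hi' := Finset.mem_range.mp hi
    exact nci_tangent (hKpos i hi') (hX1 i) (hYpos i hi') (hY1 i)
  have e1 : ∑ i, Real.log (1 - y i) = ∑ i ∈ Finset.range m, Real.log (1 - Y i) := by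
    rw [← Fin.sum_univ_eq_sum_range (fun i => Real.log (1 - Y i))]
    exact Finset.sum_congr rfl (fun i _ => by rw [hYv])
  have e2 : ∑ i, Real.log (1 - x i) = ∑ i ∈ Finset.range m, Real.log (1 - X i) := by
    rw [← Fin.sum_univ_eq_sum_range (fun i => Real.log (1 - X i))]
    exact Finset.sum_congr rfl (fun i _ => by rw [hXv])
  rw [e1, e2, ← Finset.sum_range_add_sum_Ico _ hKm, ← Finset.sum_range_add_sum_Ico _ hKm]
  refine add_le_add h1 (Finset.sum_le_sum (fun i hi => ?_))
  have : X i = 0 := le_antisymm ((hXa (Finset.mem_Ico.mp hi).1).trans hK0.le) (hX0 i)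
  rw [this]
  exact Real.log_le_log (by linarith [hY1 i]) (by linarith [hY0 i])

theorem nci_det_conj {ι : Type*} [Fintype ι] [DecidableEq ι] (U : Matrix ι ι ℂ) (hU : Uᴴ * U = 1)
    (hU' : U * Uᴴ = 1) (d : ι → ℂ) (α β : ℂ) :
    (α • (1 : Matrix ι ι ℂ) + β • (U * diagonal d * Uᴴ)).det = ∏ i, (α + β * d i) := by
  have e : α • (1 : Matrix ι ι ℂ) + β • (U * diagonal d * Uᴴ)
      = U * diagonal (fun i => α + β * d i) * Uᴴ := by
    have : diagonal (fun i => α + β * d i) = α • (1 : Matrix ι ι ℂ) + β • diagonal d := by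
      ext i j
      by_cases h : i = j
      · subst h; simp
      · simp [h]
    rw [this]
    simp only [mul_add, add_mul, Matrix.mul_smul, Matrix.smul_mul, Matrix.mul_one, hU']
  rw [e, det_mul, det_mul, mul_right_comm, ← det_mul, hU', det_one, one_mul, det_diagonal]

theorem nci_det_one_add {ι : Type*} [Fintype ι] [DecidableEq ι] {M : Matrix ι ι ℂ}
    (hM : M.IsHermitian) :
    (1 + M).det = ((∏ i, (1 + hM.eigenvalues i) : ℝ) : ℂ) := by
  obtain ⟨U, h1, h2, h3⟩ := nci_diag hM
  have := nci_det_conj U h1 h2 (fun i => (hM.eigenvalues i : ℂ)) 1 1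
  rw [← h3, one_smul, one_smul] at this
  rw [this]
  push_cast
  simp

theorem nci_invsqrt {ι : Type*} [Fintype ι] [DecidableEq ι] {M : Matrix ι ι ℂ} (hM : M.PosSemidef) :
    ∃ S I : Matrix ι ι ℂ, Sᴴ = S ∧ Iᴴ = I ∧ S * S = 1 + M ∧ S * I = 1 ∧ I * S = 1 := by
  obtain ⟨S, hS, hSS⟩ := nci_sqrt (PosSemidef.one.add hM)
  have hd : IsUnit S.det := by
    rw [isUnit_iff_ne_zero]
    intro h0
    have h1 : (1 + M).det = 0 := by rw [← hSS, det_mul, h0, zero_mul]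
    rw [nci_det_one_add hM.isHermitian] at h1
    have h2 : 0 < ∏ i, (1 + hM.isHermitian.eigenvalues i) :=
      Finset.prod_pos (fun i _ => by linarith [hM.eigenvalues_nonneg i])
    exact h2.ne' (by exact_mod_cast h1)
  have hSh : Sᴴ = S := hS.isHermitian
  exact ⟨S, S⁻¹, hSh, by rw [conjTranspose_nonsing_inv, hSh], hSS, mul_nonsing_inv _ hd,
    nonsing_inv_mul _ hd⟩

theorem nci_factor {m n : ℕ}
    (B : Matrix (Fin m) (Fin m) ℂ) (D : Matrix (Fin n) (Fin n) ℂ) (C : Matrix (Fin n) (Fin m) ℂ)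
    (hA : (Matrix.fromBlocks B Cᴴ C D).PosSemidef) :
    ∃ (Z1 : Matrix (Fin m ⊕ Fin n) (Fin m) ℂ) (Z2 : Matrix (Fin m ⊕ Fin n) (Fin n) ℂ),
      Z1ᴴ * Z1 = B ∧ Z2ᴴ * Z2 = D ∧ C = Z2ᴴ * Z1 := by
  obtain ⟨S, hS, hSS⟩ := nci_sqrt hA
  have hSh : Sᴴ = S := hS.isHermitian
  have key : ∀ i j, ∑ x, star (S x i) * S x j = fromBlocks B Cᴴ C D i j := by
    intro i j
    calc ∑ x, star (S x i) * S x j = (Sᴴ * S) i j := by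
          simp only [mul_apply, conjTranspose_apply]
      _ = _ := by rw [hSh, hSS]
  refine ⟨S.submatrix id Sum.inl, S.submatrix id Sum.inr, ?_, ?_, ?_⟩
  · ext i j; simpa [mul_apply] using key (Sum.inl i) (Sum.inl j)
  · ext i j; simpa [mul_apply] using key (Sum.inr i) (Sum.inr j)
  · ext i j; simpa [mul_apply] using (key (Sum.inr i) (Sum.inl j)).symm

/-- singular value products -/
theorem nci_prod {m n k : ℕ} (hk : k ≤ m) {N : Type*} [Fintype N]
    (Z1 : Matrix N (Fin m) ℂ) (Z2 : Matrix N (Fin n) ℂ) (C : Matrix (Fin n) (Fin m) ℂ)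
    (hC : C = Z2ᴴ * Z1)
    (SB IB : Matrix (Fin m) (Fin m) ℂ) (SD ID : Matrix (Fin n) (Fin n) ℂ)
    (hSB : SBᴴ = SB) (hIB : IBᴴ = IB) (hSB2 : SB * SB = 1 + Z1ᴴ * Z1) (hB1 : SB * IB = 1)
    (hB2 : IB * SB = 1)
    (hSD : SDᴴ = SD) (hID : IDᴴ = ID) (hSD2 : SD * SD = 1 + Z2ᴴ * Z2) (hD1 : SD * ID = 1)
    (hD2 : ID * SD = 1)
    (Uk : Matrix (Fin m) (Fin k) ℂ) (τ : Fin k → ℝ) (hτ : ∀ i, 0 < τ i)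
    (hU : Ukᴴ * Uk = 1)
    (hUd : Ukᴴ * ((ID * C * IB)ᴴ * (ID * C * IB)) * Uk = diagonal (fun i => (τ i : ℂ)))
    (U0 : Matrix (Fin m) (Fin m) ℂ) (hU0 : U0ᴴ * U0 = 1) (hU0' : U0 * U0ᴴ = 1)
    (μ : Fin m → ℝ) (hμ : Antitone μ)
    (hM : Cᴴ * C = U0 * diagonal (fun i => (μ i : ℂ)) * U0ᴴ) :
    ∏ i, τ i ≤ ∏ i : Fin k, (Real.sqrt (μ (Fin.castLE hk i)) / (1 + Real.sqrt (μ (Fin.castLE hk i)))) ^ 2 := by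
  set Y := ID * C * IB with hY
  set G : Matrix (Fin k) (Fin k) ℂ := diagonal (fun i => (((Real.sqrt (τ i))⁻¹ : ℝ) : ℂ)) with hG
  have hGh : Gᴴ = G := by rw [hG, diagonal_conjTranspose]; congr 1; ext i; simp
  have hX1 : (Z1 * (IB * Uk))ᴴ * (Z1 * (IB * Uk)) + (IB * Uk)ᴴ * (IB * Uk) = 1 := by
    calc _ = Ukᴴ * (IB * (1 + Z1ᴴ * Z1) * IB) * Uk := by
          simp only [conjTranspose_mul, hIB, Matrix.mul_add, Matrix.add_mul, Matrix.mul_assoc,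
            Matrix.one_mul, Matrix.mul_one]
          abel
      _ = Ukᴴ * ((IB * SB) * (SB * IB)) * Uk := by rw [← hSB2]; simp only [Matrix.mul_assoc]
      _ = 1 := by rw [hB1, hB2, Matrix.one_mul, Matrix.mul_one, hU]
  have hY1 : (Z2 * (ID * Y * Uk * G))ᴴ * (Z2 * (ID * Y * Uk * G)) +
      (ID * Y * Uk * G)ᴴ * (ID * Y * Uk * G) = 1 := by
    calc _ = G * (Ukᴴ * (Yᴴ * (ID * (1 + Z2ᴴ * Z2) * ID) * Y) * Uk) * G := by
          simp only [conjTranspose_mul, hID, hGh, Matrix.mul_add, Matrix.add_mul, Matrix.mul_assoc,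
            Matrix.one_mul, Matrix.mul_one]
          abel
      _ = G * (Ukᴴ * (Yᴴ * ((ID * SD) * (SD * ID)) * Y) * Uk) * G := by
          rw [← hSD2]; simp only [Matrix.mul_assoc]
      _ = G * diagonal (fun i => (τ i : ℂ)) * G := by
          rw [hD1, hD2, Matrix.one_mul, Matrix.mul_one, hUd]
      _ = 1 := by
          rw [hG, diagonal_mul_diagonal, diagonal_mul_diagonal, ← diagonal_one]
          congr 1; ext i
          rw [← Complex.ofReal_mul, ← Complex.ofReal_mul]
          have h1 := Real.mul_self_sqrt (hτ i).le
          have h2 := Real.sqrt_pos.mpr (hτ i)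
          have : (√(τ i))⁻¹ * τ i * (√(τ i))⁻¹ = 1 := by
            field_simp; nlinarith
          rw [this]; simp
  have hγ : (ID * Y * Uk * G)ᴴ * C * (IB * Uk) = diagonal (fun i => ((Real.sqrt (τ i) : ℝ) : ℂ)) := by
    calc _ = G * (Ukᴴ * (Yᴴ * (ID * C * IB)) * Uk) := by
          simp only [conjTranspose_mul, hID, hGh, Matrix.mul_assoc]
      _ = G * diagonal (fun i => (τ i : ℂ)) := by rw [← hY, hUd]
      _ = _ := by
          rw [hG, diagonal_mul_diagonal]
          congr 1; ext i
          rw [← Complex.ofReal_mul]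
          have h1 := Real.mul_self_sqrt (hτ i).le
          have h2 := Real.sqrt_pos.mpr (hτ i)
          have : (√(τ i))⁻¹ * τ i = √(τ i) := by
            field_simp; nlinarith
          rw [this]
  have hsp : 0 < ∏ i, Real.sqrt (τ i) := Finset.prod_pos (fun i _ => Real.sqrt_pos.mpr (hτ i))
  have hdγ : ((ID * Y * Uk * G)ᴴ * C * (IB * Uk)).det = ((∏ i, Real.sqrt (τ i) : ℝ) : ℂ) := by
    rw [hγ, det_diagonal]; push_cast; rfl
  obtain ⟨O, R, hO, hR, hRR, hle⟩ := nci_core Z1 Z2 C hC (IB * Uk) (ID * Y * Uk * G) hX1 hY1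
    (by rw [hdγ]; exact_mod_cast hsp.ne')
  obtain ⟨V, e, hV1, hV2, hanti, hRd⟩ := nci_diag_sorted hR.isHermitian
  set r : Fin k → ℝ := fun i => hR.isHermitian.eigenvalues (e i) with hr
  have hRd' : R = V * diagonal (fun i => (r i : ℂ)) * Vᴴ := hRd
  have hr0 : ∀ i, 0 ≤ r i := fun i => hR.eigenvalues_nonneg _
  have hdR : R.det = ((∏ i, r i : ℝ) : ℂ) := by
    have := nci_det_conj V hV1 hV2 (fun i => (r i : ℂ)) 0 1
    rw [← hRd, zero_smul, one_smul, zero_add] at this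
    rw [this]; push_cast; simp
  have hdR1 : (1 + R).det = ((∏ i, (1 + r i) : ℝ) : ℂ) := by
    have := nci_det_conj V hV1 hV2 (fun i => (r i : ℂ)) 1 1
    rw [← hRd, one_smul, one_smul] at this
    rw [this]; push_cast; simp
  have hp1 : 0 < ∏ i, (1 + r i) := Finset.prod_pos (fun i _ => by linarith [hr0 i])
  have hp0 : 0 ≤ ∏ i, r i := Finset.prod_nonneg (fun i _ => hr0 i)
  rw [hdγ, hdR, hdR1, Complex.norm_real, Complex.norm_real, Complex.norm_real,
    Real.norm_of_nonneg hsp.le, Real.norm_of_nonneg hp0, Real.norm_of_nonneg hp1.le] at hle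
  -- interlacing
  have hint : ∀ j : Fin k, (r j)^2 ≤ μ (Fin.castLE hk j) := by
    refine nci_interlace hk (U0ᴴ * (O * V)) μ (fun j => (r j)^2) hμ ?_ ?_ ?_
    · intro i j hij
      have := hanti hij
      exact pow_le_pow_left₀ (hr0 j) this 2
    · calc _ = Vᴴ * (Oᴴ * (U0 * U0ᴴ) * O) * V := by
            simp only [conjTranspose_mul, conjTranspose_conjTranspose, Matrix.mul_assoc]
        _ = 1 := by rw [hU0', Matrix.mul_one, hO, Matrix.mul_one, hV1]
    · calc _ = Vᴴ * (Oᴴ * (U0 * diagonal (fun i => (μ i : ℂ)) * U0ᴴ) * O) * V := by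
            simp only [conjTranspose_mul, conjTranspose_conjTranspose, Matrix.mul_assoc]
        _ = Vᴴ * (R * R) * V := by rw [← hM, hRR]
        _ = (Vᴴ * V) * diagonal (fun i => (r i : ℂ)) * (Vᴴ * V) * diagonal (fun i => (r i : ℂ)) * (Vᴴ * V) := by
            rw [hRd']; simp only [Matrix.mul_assoc]
        _ = _ := by
            rw [hV1]; simp only [Matrix.one_mul, Matrix.mul_one, diagonal_mul_diagonal]
            congr 1; ext i; push_cast; ring
  have h1 : ∏ i, Real.sqrt (τ i) ≤ ∏ i, r i / (1 + r i) := by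
    rw [Finset.prod_div_distrib, le_div_iff₀ hp1]; exact hle
  have h2 : ∏ i, r i / (1 + r i) ≤ ∏ i : Fin k, (Real.sqrt (μ (Fin.castLE hk i)) / (1 + Real.sqrt (μ (Fin.castLE hk i)))) := by
    refine Finset.prod_le_prod (fun i _ => div_nonneg (hr0 i) (by linarith [hr0 i])) (fun i _ => ?_)
    have h3 : r i ≤ Real.sqrt (μ (Fin.castLE hk i)) := Real.le_sqrt_of_sq_le (hint i)
    have := hr0 i
    rw [div_le_div_iff₀ (by linarith) (by linarith)]
    nlinarith
  calc ∏ i, τ i = (∏ i, Real.sqrt (τ i))^2 := by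
        rw [← Finset.prod_pow]; exact Finset.prod_congr rfl (fun i _ => (Real.sq_sqrt (hτ i).le).symm)
    _ ≤ _ := by
        rw [Finset.prod_pow]; exact pow_le_pow_left₀ hsp.le (h1.trans h2) 2

theorem nci_point {m n : ℕ}
    (B : Matrix (Fin m) (Fin m) ℂ) (D : Matrix (Fin n) (Fin n) ℂ) (C : Matrix (Fin n) (Fin m) ℂ)
    (hA : (Matrix.fromBlocks B Cᴴ C D).PosSemidef) (hB : B.PosSemidef) (hD : D.PosSemidef)
    (hM : (Cᴴ * C).PosSemidef) :
    0 ≤ ∑ i, Real.log (1 + hA.isHermitian.eigenvalues i) - ∑ i, Real.log (1 + hB.isHermitian.eigenvalues i)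
      - ∑ i, Real.log (1 + hD.isHermitian.eigenvalues i)
      + ∑ i, (2 * Real.log (1 + Real.sqrt (hM.isHermitian.eigenvalues i))
          - Real.log (1 + 2 * Real.sqrt (hM.isHermitian.eigenvalues i))) := by
  obtain ⟨Z1, Z2, hZ1, hZ2, hC⟩ := nci_factor B D C hA
  obtain ⟨SB, IB, hSB, hIB, hSB2, hB1, hB2⟩ := nci_invsqrt hB
  obtain ⟨SD, ID, hSD, hID, hSD2, hD1, hD2⟩ := nci_invsqrt hD
  have hP := posSemidef_conjTranspose_mul_self (ID * C * IB)
  set Y := ID * C * IB with hY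
  obtain ⟨U, e, hU1, hU2, hanti, hUd⟩ := nci_diag_sorted hP.isHermitian
  obtain ⟨U0, e0, hU01, hU02, hanti0, hU0d⟩ := nci_diag_sorted hM.isHermitian
  set τ : Fin m → ℝ := fun i => hP.isHermitian.eigenvalues (e i) with hτ
  set μ : Fin m → ℝ := fun i => hM.isHermitian.eigenvalues (e0 i) with hμ
  have hUd' : Yᴴ * Y = U * diagonal (fun i => (τ i : ℂ)) * Uᴴ := hUd
  have hτ0 : ∀ i, 0 ≤ τ i := fun i => hP.eigenvalues_nonneg _
  -- determinant identity
  have hdet : (1 + fromBlocks B Cᴴ C D).det = (1 + B).det * (1 + D).det * (1 - Yᴴ * Y).det := by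
    have e1 : (1 : Matrix (Fin m ⊕ Fin n) (Fin m ⊕ Fin n) ℂ) + fromBlocks B Cᴴ C D
        = fromBlocks (1 + B) Cᴴ C (1 + D) := by
      rw [← fromBlocks_one, fromBlocks_add, zero_add, zero_add]
    have hinv : (1 + B) * (IB * IB) = 1 := by
      rw [← hSB2]
      calc _ = SB * (SB * IB) * IB := by simp only [Matrix.mul_assoc]
        _ = 1 := by rw [hB1, Matrix.mul_one, hB1]
    have hinv' : (IB * IB) * (1 + B) = 1 := mul_eq_one_comm.mp hinv
    letI : Invertible (1 + B) := ⟨IB * IB, hinv', hinv⟩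
    rw [e1, det_fromBlocks₁₁]
    have e2 : 1 + D - C * ⅟(1 + B) * Cᴴ = SD * (1 - Y * Yᴴ) * SD := by
      show 1 + D - C * (IB * IB) * Cᴴ = _
      calc _ = SD * SD - (SD * ID) * C * (IB * IB) * Cᴴ * (ID * SD) := by
            rw [hD1, hD2, hSD2]; simp
        _ = _ := by
            rw [hY]
            simp only [conjTranspose_mul, hIB, hID, Matrix.mul_sub, Matrix.sub_mul, Matrix.mul_assoc,
              Matrix.one_mul, Matrix.mul_one]
    rw [e2, det_mul, det_mul, det_one_sub_mul_comm Y, ← hSD2, det_mul]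
    ring
  have hd1 : (1 - Yᴴ * Y).det = ((∏ i, (1 - τ i) : ℝ) : ℂ) := by
    have := nci_det_conj U hU1 hU2 (fun i => (τ i : ℂ)) 1 (-1)
    rw [← hUd, one_smul, neg_one_smul, ← sub_eq_add_neg] at this
    rw [this]; push_cast
    exact Finset.prod_congr rfl (fun i _ => by ring)
  rw [nci_det_one_add hA.isHermitian, nci_det_one_add hB.isHermitian, nci_det_one_add hD.isHermitian,
    hd1] at hdet
  have hdet' : ∏ i, (1 + hA.isHermitian.eigenvalues i) = (∏ i, (1 + hB.isHermitian.eigenvalues i)) *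
      (∏ i, (1 + hD.isHermitian.eigenvalues i)) * ∏ i, (1 - τ i) := by exact_mod_cast hdet
  have hpA : ∀ i, 0 < 1 + hA.isHermitian.eigenvalues i := fun i => by linarith [hA.eigenvalues_nonneg i]
  have hpB : ∀ i, 0 < 1 + hB.isHermitian.eigenvalues i := fun i => by linarith [hB.eigenvalues_nonneg i]
  have hpD : ∀ i, 0 < 1 + hD.isHermitian.eigenvalues i := fun i => by linarith [hD.eigenvalues_nonneg i]
  have hne : ∀ i, 1 - τ i ≠ 0 := by
    have : ∏ i, (1 - τ i) ≠ 0 := by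
      intro h0
      rw [h0, mul_zero] at hdet'
      exact (Finset.prod_pos (fun i _ => hpA i)).ne' hdet'
    intro i
    exact (Finset.prod_ne_zero_iff.mp this) i (Finset.mem_univ i)
  have hYY : (1 - Yᴴ * Y).PosSemidef := by
    have hQ : (Z2 * ID)ᴴ * (Z2 * ID) + IDᴴ * ID = 1 := by
      calc _ = ID * (1 + Z2ᴴ * Z2) * ID := by
            simp only [conjTranspose_mul, hID, Matrix.mul_add, Matrix.add_mul, Matrix.mul_assoc,
              Matrix.one_mul, Matrix.mul_one]
            abel
        _ = (ID * SD) * (SD * ID) := by rw [hZ2, ← hSD2]; simp only [Matrix.mul_assoc]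
        _ = 1 := by rw [hD1, hD2, Matrix.mul_one]
    have h1 := nci_contr' (Z1 * IB) (Z2 * ID) (0 : Matrix (Fin n) (Fin m) ℂ) ID hQ Y (by
      rw [hY, hC]; simp only [conjTranspose_mul, hID, Matrix.mul_assoc, Matrix.mul_zero, add_zero])
    have h2 := h1.add (posSemidef_conjTranspose_mul_self IB)
    have h3 : (Z1 * IB)ᴴ * (Z1 * IB) + IBᴴ * IB = 1 := by
      calc _ = IB * (1 + Z1ᴴ * Z1) * IB := by
            simp only [conjTranspose_mul, hIB, Matrix.mul_add, Matrix.add_mul, Matrix.mul_assoc,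
              Matrix.one_mul, Matrix.mul_one]
            abel
        _ = (IB * SB) * (SB * IB) := by rw [hZ1, ← hSB2]; simp only [Matrix.mul_assoc]
        _ = 1 := by rw [hB1, hB2, Matrix.mul_one]
    rw [← h3]
    convert h2 using 1
    simp only [Matrix.mul_zero, add_zero]
    abel
  have hτ1 : ∀ i, τ i < 1 := by
    intro i
    have h4 := hYY.conjTranspose_mul_mul_same U
    have e : Uᴴ * (1 - Yᴴ * Y) * U = 1 - diagonal (fun i => (τ i : ℂ)) := by
      rw [hUd']
      calc _ = Uᴴ * U - (Uᴴ * U) * diagonal (fun i => (τ i : ℂ)) * (Uᴴ * U) := by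
            simp only [mul_sub, sub_mul, mul_assoc, mul_one]
        _ = _ := by simp [hU1]
    rw [e] at h4
    have := h4.diag_nonneg (i := i)
    simp only [Matrix.sub_apply, one_apply_eq, diagonal_apply_eq] at this
    have h5 : (0 : ℝ) ≤ 1 - τ i := by exact_mod_cast this
    exact sub_pos.mp (lt_of_le_of_ne h5 (hne i).symm)
  have hmaj := nci_major τ (fun i => (Real.sqrt (μ i) / (1 + Real.sqrt (μ i))) ^ 2) hanti hτ0 hτ1
    (fun i => sq_nonneg _)
    (fun i => by
      have h0 := Real.sqrt_nonneg (μ i)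
      have h1 : Real.sqrt (μ i) / (1 + Real.sqrt (μ i)) < 1 := by
        rw [div_lt_one (by linarith)]; linarith
      have h2 : 0 ≤ Real.sqrt (μ i) / (1 + Real.sqrt (μ i)) := by positivity
      show (Real.sqrt (μ i) / (1 + Real.sqrt (μ i))) ^ 2 < 1
      nlinarith)
    (fun k hk hpos => by
      have hsub : ∀ W : Matrix (Fin m) (Fin m) ℂ, (U.submatrix id (Fin.castLE hk))ᴴ * W *
          U.submatrix id (Fin.castLE hk) = (Uᴴ * W * U).submatrix (Fin.castLE hk) (Fin.castLE hk) := by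
        intro W; ext i j; simp [mul_apply]
      refine nci_prod hk Z1 Z2 C hC SB IB SD ID hSB hIB (by rw [hZ1, hSB2]) hB1 hB2 hSD hID
        (by rw [hZ2, hSD2]) hD1 hD2 (U.submatrix id (Fin.castLE hk)) (fun i => τ (Fin.castLE hk i)) hpos
        ?_ ?_ U0 hU01 hU02 μ hanti0 hU0d
      · have := hsub 1
        rw [Matrix.mul_one, Matrix.mul_one, hU1] at this
        rw [this]; ext i j; simp [one_apply]
      · rw [hsub, ← hY, hUd']
        have : Uᴴ * (U * diagonal (fun i => (τ i : ℂ)) * Uᴴ) * U = diagonal (fun i => (τ i : ℂ)) := by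
          calc _ = (Uᴴ * U) * diagonal (fun i => (τ i : ℂ)) * (Uᴴ * U) := by simp only [mul_assoc]
            _ = _ := by simp [hU1]
        rw [this]
        ext i j; simp [diagonal_apply])
  have hlog : ∑ i, Real.log (1 + hA.isHermitian.eigenvalues i) = ∑ i, Real.log (1 + hB.isHermitian.eigenvalues i)
      + ∑ i, Real.log (1 + hD.isHermitian.eigenvalues i) + ∑ i, Real.log (1 - τ i) := by
    rw [← Real.log_prod (fun i _ => (hpA i).ne'), ← Real.log_prod (fun i _ => (hpB i).ne'),
      ← Real.log_prod (fun i _ => (hpD i).ne'), ← Real.log_prod (fun i _ => hne i), hdet',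
      Real.log_mul (mul_ne_zero (Finset.prod_pos (fun i _ => hpB i)).ne' (Finset.prod_pos (fun i _ => hpD i)).ne')
        (Finset.prod_ne_zero_iff.mpr (fun i _ => hne i)),
      Real.log_mul (Finset.prod_pos (fun i _ => hpB i)).ne' (Finset.prod_pos (fun i _ => hpD i)).ne']
  have hy : ∑ i, (2 * Real.log (1 + Real.sqrt (hM.isHermitian.eigenvalues i))
          - Real.log (1 + 2 * Real.sqrt (hM.isHermitian.eigenvalues i)))
      = - ∑ i, Real.log (1 - (Real.sqrt (μ i) / (1 + Real.sqrt (μ i))) ^ 2) := by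
    rw [← Equiv.sum_comp e0, ← Finset.sum_neg_distrib]
    refine Finset.sum_congr rfl (fun i _ => ?_)
    show 2 * Real.log (1 + Real.sqrt (μ i)) - Real.log (1 + 2 * Real.sqrt (μ i)) = _
    have h0 := Real.sqrt_nonneg (μ i)
    set p := Real.sqrt (μ i)
    have : 1 - (p / (1 + p))^2 = (1 + 2 * p) / (1 + p)^2 := by field_simp; ring
    rw [this, Real.log_div (by positivity) (by positivity), Real.log_pow]
    push_cast; ring
  rw [hlog, hy]
  linarith

theorem nci_int_one (h : ℝ → ℝ) (q : ℝ) (hq : 0 < q) (h0 : h 0 = 0)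
    (hint : MeasureTheory.IntegrableOn (fun s : ℝ => s ^ (-q - 1) * h s) (Set.Ioi 0))
    (x : ℝ) (hx : 0 ≤ x) :
    MeasureTheory.IntegrableOn (fun s : ℝ => s ^ (-q - 1) * h (s * x)) (Set.Ioi 0) ∧
    ∫ s in Set.Ioi (0 : ℝ), s ^ (-q - 1) * h (s * x)
      = x ^ q * ∫ s in Set.Ioi (0 : ℝ), s ^ (-q - 1) * h s := by
  rcases hx.eq_or_lt with rfl | hx
  · simp [h0, Real.zero_rpow hq.ne', MeasureTheory.integrableOn_zero]
  · have e : Set.EqOn (fun s : ℝ => x ^ (q + 1) * (fun s : ℝ => s ^ (-q - 1) * h s) (x * s))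
        (fun s : ℝ => s ^ (-q - 1) * h (s * x)) (Set.Ioi 0) := by
      intro s hs
      have hs : 0 < s := hs
      show x ^ (q + 1) * ((x * s) ^ (-q - 1) * h (x * s)) = _
      rw [Real.mul_rpow hx.le hs.le, mul_comm x s]
      have : x ^ (q + 1) * x ^ (-q - 1) = 1 := by
        rw [← Real.rpow_add hx]; ring_nf; exact Real.rpow_zero x
      calc _ = (x ^ (q + 1) * x ^ (-q - 1)) * (s ^ (-q - 1) * h (s * x)) := by ring
        _ = _ := by rw [this, one_mul]
    constructor
    · refine MeasureTheory.IntegrableOn.congr_fun ?_ e measurableSet_Ioi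
      refine MeasureTheory.Integrable.const_mul ?_ _
      have := (MeasureTheory.integrableOn_Ioi_comp_mul_left_iff
        (fun s : ℝ => s ^ (-q - 1) * h s) 0 hx).mpr (by simpa using hint)
      exact this
    · rw [← MeasureTheory.setIntegral_congr_fun measurableSet_Ioi e,
        MeasureTheory.integral_const_mul, MeasureTheory.integral_comp_mul_left_Ioi (fun s : ℝ => s ^ (-q - 1) * h s) _ hx, mul_zero,
        smul_eq_mul, ← mul_assoc, Real.rpow_add_one hx.ne', mul_assoc (x ^ q), mul_inv_cancel₀ hx.ne', mul_one]

theorem nci_int_sum {α : Type*} [Fintype α] (h : ℝ → ℝ) (q : ℝ) (hq : 0 < q) (h0 : h 0 = 0)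
    (hint : MeasureTheory.IntegrableOn (fun s : ℝ => s ^ (-q - 1) * h s) (Set.Ioi 0))
    (x : α → ℝ) (hx : ∀ i, 0 ≤ x i) :
    MeasureTheory.IntegrableOn (fun s : ℝ => ∑ i, s ^ (-q - 1) * h (s * x i)) (Set.Ioi 0) ∧
    ∫ s in Set.Ioi (0 : ℝ), ∑ i, s ^ (-q - 1) * h (s * x i)
      = (∑ i, x i ^ q) * ∫ s in Set.Ioi (0 : ℝ), s ^ (-q - 1) * h s := by
  constructor
  · exact MeasureTheory.integrable_finsetSum _ (fun i _ => (nci_int_one h q hq h0 hint _ (hx i)).1)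
  · rw [MeasureTheory.integral_finsetSum _ (fun i _ => (nci_int_one h q hq h0 hint _ (hx i)).1),
      Finset.sum_mul]
    exact Finset.sum_congr rfl (fun i _ => (nci_int_one h q hq h0 hint _ (hx i)).2)

theorem nci_int {α β γ δ : Type*} [Fintype α] [Fintype β] [Fintype γ] [Fintype δ]
    (h : ℝ → ℝ) (q : ℝ) (hq : 0 < q) (h0 : h 0 = 0) (hpos : ∀ s, 0 < s → 0 < h s)
    (hint : MeasureTheory.IntegrableOn (fun s : ℝ => s ^ (-q - 1) * h s) (Set.Ioi 0))
    (a : α → ℝ) (b : β → ℝ) (d : γ → ℝ) (p : δ → ℝ)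
    (ha : ∀ i, 0 ≤ a i) (hb : ∀ i, 0 ≤ b i) (hd : ∀ i, 0 ≤ d i) (hp : ∀ i, 0 ≤ p i)
    (H : ∀ s : ℝ, 0 < s → 0 ≤ ∑ i, h (s * a i) - ∑ i, h (s * b i) - ∑ i, h (s * d i)
      + (2 * ∑ i, h (s * p i) - ∑ i, h (s * (2 * p i)))) :
    0 ≤ ∑ i, a i ^ q - ∑ i, b i ^ q - ∑ i, d i ^ q + (2 - 2 ^ q) * ∑ i, p i ^ q := by
  obtain ⟨ia, ea⟩ := nci_int_sum h q hq h0 hint a ha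
  obtain ⟨ib, eb⟩ := nci_int_sum h q hq h0 hint b hb
  obtain ⟨id', ed⟩ := nci_int_sum h q hq h0 hint d hd
  obtain ⟨ip, ep⟩ := nci_int_sum h q hq h0 hint p hp
  obtain ⟨ir, er⟩ := nci_int_sum h q hq h0 hint (fun i => 2 * p i) (fun i => by linarith [hp i])
  have hc : 0 < ∫ s in Set.Ioi (0 : ℝ), s ^ (-q - 1) * h s := by
    rw [MeasureTheory.setIntegral_pos_iff_support_of_nonneg_ae ?_ hint]
    · have : Function.support (fun s : ℝ => s ^ (-q - 1) * h s) ∩ Set.Ioi 0 = Set.Ioi 0 := by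
        ext s
        simp only [Set.mem_inter_iff, Function.mem_support, Set.mem_Ioi, and_iff_right_iff_imp]
        intro hs
        exact (mul_pos (Real.rpow_pos_of_pos hs _) (hpos s hs)).ne'
      rw [this]; simp
    · refine MeasureTheory.ae_restrict_of_forall_mem measurableSet_Ioi (fun s hs => ?_)
      exact (mul_pos (Real.rpow_pos_of_pos hs _) (hpos s hs)).le
  set c := ∫ s in Set.Ioi (0 : ℝ), s ^ (-q - 1) * h s with hcdef
  have hI := MeasureTheory.setIntegral_nonneg (μ := MeasureTheory.volume) (measurableSet_Ioi (a := (0 : ℝ)))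
    (f := fun s : ℝ => (∑ i, s ^ (-q - 1) * h (s * a i) - ∑ i, s ^ (-q - 1) * h (s * b i)
      - ∑ i, s ^ (-q - 1) * h (s * d i)) + (2 * (∑ i, s ^ (-q - 1) * h (s * p i))
      - ∑ i, s ^ (-q - 1) * h (s * (2 * p i)))) (fun s hs => by
        have hs : 0 < s := hs
        have := mul_nonneg (Real.rpow_pos_of_pos hs (-q - 1)).le (H s hs)
        simp only [← Finset.mul_sum]
        linarith)
  have iab : MeasureTheory.IntegrableOn (fun s : ℝ => ∑ i, s ^ (-q - 1) * h (s * a i)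
      - ∑ i, s ^ (-q - 1) * h (s * b i)) (Set.Ioi 0) := ia.sub ib
  have iabd : MeasureTheory.IntegrableOn (fun s : ℝ => ∑ i, s ^ (-q - 1) * h (s * a i)
      - ∑ i, s ^ (-q - 1) * h (s * b i) - ∑ i, s ^ (-q - 1) * h (s * d i)) (Set.Ioi 0) := iab.sub id'
  have ipr : MeasureTheory.IntegrableOn (fun s : ℝ => 2 * (∑ i, s ^ (-q - 1) * h (s * p i))
      - ∑ i, s ^ (-q - 1) * h (s * (2 * p i))) (Set.Ioi 0) := (ip.const_mul 2).sub ir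
  rw [MeasureTheory.integral_add iabd ipr,
    MeasureTheory.integral_sub iab id', MeasureTheory.integral_sub ia ib,
    MeasureTheory.integral_sub (ip.const_mul 2) ir, MeasureTheory.integral_const_mul,
    ea, eb, ed, ep, er] at hI
  have e2 : ∑ i, (2 * p i) ^ q = 2 ^ q * ∑ i, p i ^ q := by
    rw [Finset.mul_sum]
    exact Finset.sum_congr rfl (fun i _ => Real.mul_rpow (by norm_num) (hp i))
  rw [e2] at hI
  refine nonneg_of_mul_nonneg_left (b := c) ?_ hc
  linarith

theorem nci_intble (h : ℝ → ℝ) (q r t : ℝ) (K L : ℝ) (hm : Measurable h) (hr : q < r) (ht : t < q)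
    (h0 : ∀ s, 0 < s → 0 ≤ h s)
    (h1 : ∀ s, 0 < s → s < 1 → h s ≤ K * s ^ r) (h2 : ∀ s, 1 ≤ s → h s ≤ L * s ^ t) :
    MeasureTheory.IntegrableOn (fun s : ℝ => s ^ (-q - 1) * h s) (Set.Ioi 0) := by
  have hmeas : Measurable (fun s : ℝ => s ^ (-q - 1) * h s) := by fun_prop
  have e : Set.Ioi (0 : ℝ) = Set.Ioo 0 1 ∪ Set.Ici 1 := by
    ext x; simp only [Set.mem_Ioi, Set.mem_union, Set.mem_Ioo, Set.mem_Ici]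
    constructor
    · intro hx
      rcases lt_or_ge x 1 with h | h
      · exact Or.inl ⟨hx, h⟩
      · exact Or.inr h
    · rintro (h | h) <;> linarith
  rw [e]
  refine MeasureTheory.IntegrableOn.union ?_ ?_
  · have : MeasureTheory.IntegrableOn (fun s : ℝ => K * s ^ (r - q - 1)) (Set.Ioo 0 1) :=
      ((intervalIntegral.integrableOn_Ioo_rpow_iff zero_lt_one).mpr (by linarith)).const_mul K
    refine MeasureTheory.Integrable.mono' this hmeas.aestronglyMeasurable ?_
    refine MeasureTheory.ae_restrict_of_forall_mem measurableSet_Ioo (fun s hs => ?_)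
    have hp := Real.rpow_pos_of_pos hs.1 (-q - 1)
    rw [Real.norm_of_nonneg (mul_nonneg hp.le (h0 s hs.1))]
    calc _ ≤ s ^ (-q - 1) * (K * s ^ r) := mul_le_mul_of_nonneg_left (h1 s hs.1 hs.2) hp.le
      _ = K * (s ^ r * s ^ (-q - 1)) := by ring
      _ = _ := by rw [← Real.rpow_add hs.1]; ring_nf
  · rw [integrableOn_Ici_iff_integrableOn_Ioi]
    have : MeasureTheory.IntegrableOn (fun s : ℝ => L * s ^ (t - q - 1)) (Set.Ioi 1) :=
      (integrableOn_Ioi_rpow_of_lt (by linarith) zero_lt_one).const_mul L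
    refine MeasureTheory.Integrable.mono' this hmeas.aestronglyMeasurable ?_
    refine MeasureTheory.ae_restrict_of_forall_mem measurableSet_Ioi (fun s hs => ?_)
    have hs1 : 1 < s := hs
    have hs0 : 0 < s := by linarith
    have hp := Real.rpow_pos_of_pos hs0 (-q - 1)
    rw [Real.norm_of_nonneg (mul_nonneg hp.le (h0 s hs0))]
    calc _ ≤ s ^ (-q - 1) * (L * s ^ t) := mul_le_mul_of_nonneg_left (h2 s hs1.le) hp.le
      _ = L * (s ^ t * s ^ (-q - 1)) := by ring
      _ = _ := by rw [← Real.rpow_add hs0]; ring_nf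

theorem nci_log_bounds (s : ℝ) (hs : 0 < s) :
    0 < Real.log (1 + s) - s + s ^ 2 / 2 ∧ Real.log (1 + s) - s + s ^ 2 / 2 ≤ s ^ 3 := by
  have hd : ∀ x : ℝ, 0 ≤ x → HasDerivAt (fun x : ℝ => Real.log (1 + x)) (1 / (1 + x)) x := by
    intro x hx
    exact ((hasDerivAt_id x).const_add 1).log (by simp; linarith)
  have hd1 : ∀ x : ℝ, 0 ≤ x → HasDerivAt (fun x : ℝ => Real.log (1 + x) - x + x ^ 2 / 2)
      (1 / (1 + x) - 1 + x) x := by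
    intro x hx
    have := ((hd x hx).sub (hasDerivAt_id x)).add ((hasDerivAt_pow 2 x).div_const 2)
    exact this.congr_deriv (by norm_num)
  constructor
  · have hm : StrictMonoOn (fun x : ℝ => Real.log (1 + x) - x + x ^ 2 / 2) (Set.Ici 0) := by
      refine strictMonoOn_of_deriv_pos (convex_Ici 0)
        (fun x hx => (hd1 x hx).continuousAt.continuousWithinAt) (fun x hx => ?_)
      rw [interior_Ici, Set.mem_Ioi] at hx
      rw [(hd1 x hx.le).deriv]
      have : 1 / (1 + x) - 1 + x = x ^ 2 / (1 + x) := by field_simp; ring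
      rw [this]; positivity
    have := hm (Set.mem_Ici.mpr le_rfl) (Set.mem_Ici.mpr hs.le) hs
    simpa using this
  · have hd2 : ∀ x : ℝ, 0 ≤ x → HasDerivAt (fun x : ℝ => x ^ 3 - (Real.log (1 + x) - x + x ^ 2 / 2))
        (3 * x ^ 2 - (1 / (1 + x) - 1 + x)) x := by
      intro x hx
      have := (hasDerivAt_pow 3 x).sub (hd1 x hx)
      exact this.congr_deriv (by norm_num)
    have hm : MonotoneOn (fun x : ℝ => x ^ 3 - (Real.log (1 + x) - x + x ^ 2 / 2)) (Set.Ici 0) := by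
      refine monotoneOn_of_deriv_nonneg (convex_Ici 0)
        (fun x hx => (hd2 x hx).continuousAt.continuousWithinAt)
        (fun x hx => ((hd2 x (interior_subset hx)).differentiableAt).differentiableWithinAt) (fun x hx => ?_)
      rw [interior_Ici, Set.mem_Ioi] at hx
      rw [(hd2 x hx.le).deriv]
      have : 3 * x ^ 2 - (1 / (1 + x) - 1 + x) = (2 * x ^ 2 + 3 * x ^ 3) / (1 + x) := by field_simp; ring
      rw [this]; positivity
    have := hm (Set.mem_Ici.mpr le_rfl) (Set.mem_Ici.mpr hs.le) hs.le
    simp at this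
    linarith

theorem nci_open {α β γ δ : Type*} [Fintype α] [Fintype β] [Fintype γ] [Fintype δ]
    (q : ℝ) (hq : (0 < q ∧ q < 1) ∨ (2 < q ∧ q < 3))
    (a : α → ℝ) (b : β → ℝ) (d : γ → ℝ) (p : δ → ℝ)
    (ha : ∀ i, 0 ≤ a i) (hb : ∀ i, 0 ≤ b i) (hd : ∀ i, 0 ≤ d i) (hp : ∀ i, 0 ≤ p i)
    (t1 : ∑ i, a i = ∑ i, b i + ∑ i, d i)
    (t2 : ∑ i, a i ^ 2 = ∑ i, b i ^ 2 + ∑ i, d i ^ 2 + 2 * ∑ i, p i ^ 2)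
    (H : ∀ s : ℝ, 0 < s → 0 ≤ ∑ i, Real.log (1 + s * a i) - ∑ i, Real.log (1 + s * b i)
      - ∑ i, Real.log (1 + s * d i)
      + (2 * ∑ i, Real.log (1 + s * p i) - ∑ i, Real.log (1 + s * (2 * p i)))) :
    0 ≤ ∑ i, a i ^ q - ∑ i, b i ^ q - ∑ i, d i ^ q + (2 - 2 ^ q) * ∑ i, p i ^ q := by
  rcases hq with ⟨h0, h1⟩ | ⟨h2, h3⟩
  · refine nci_int (fun x => Real.log (1 + x)) q h0 (by simp) (fun s hs => Real.log_pos (by linarith)) ?_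
      a b d p ha hb hd hp H
    have hle : ∀ s : ℝ, 0 < s → Real.log (1 + s) ≤ s := fun s hs => by
      have := Real.log_le_sub_one_of_pos (x := 1 + s) (by linarith)
      linarith
    refine nci_intble _ q 1 (q / 2) 1 (2 ^ (q / 2) / (q / 2)) (by fun_prop) h1 (by linarith)
      (fun s hs => Real.log_nonneg (by linarith)) (fun s hs _ => by simpa using hle s hs) (fun s hs => ?_)
    have := Real.log_le_rpow_div (x := 1 + s) (ε := q / 2) (by linarith) (by linarith)
    refine this.trans ?_
    rw [div_mul_eq_mul_div, ← Real.mul_rpow (by norm_num) (by linarith)]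
    have : (1 + s) ^ (q / 2) ≤ (2 * s) ^ (q / 2) :=
      Real.rpow_le_rpow (by linarith) (by linarith) (by linarith)
    gcongr
  · refine nci_int (fun x => Real.log (1 + x) - x + x ^ 2 / 2) q (by linarith) (by simp)
      (fun s hs => (nci_log_bounds s hs).1) ?_ a b d p ha hb hd hp ?_
    · refine nci_intble _ q 3 2 1 1 (by fun_prop) h3 h2 (fun s hs => (nci_log_bounds s hs).1.le)
        (fun s hs _ => ?_) (fun s hs => ?_)
      · have := (nci_log_bounds s hs).2
        rw [one_mul]; exact_mod_cast this
      · have := Real.log_le_sub_one_of_pos (x := 1 + s) (by linarith)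
        have e : s ^ (2 : ℝ) = s ^ 2 := by exact_mod_cast Real.rpow_natCast s 2
        rw [one_mul, e]
        nlinarith
    · intro s hs
      have := H s hs
      simp only [mul_pow, Finset.sum_add_distrib, Finset.sum_sub_distrib, ← Finset.mul_sum,
        ← Finset.sum_div]
      have e1 := congrArg (fun x => s * x) t1
      have e2 := congrArg (fun x => s ^ 2 * x / 2) t2
      linarith

theorem nci_closed {α β γ δ : Type*} [Fintype α] [Fintype β] [Fintype γ] [Fintype δ]
    (q : ℝ) (hq : (0 < q ∧ q ≤ 1) ∨ (2 ≤ q ∧ q ≤ 3))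
    (a : α → ℝ) (b : β → ℝ) (d : γ → ℝ) (p : δ → ℝ)
    (ha : ∀ i, 0 ≤ a i) (hb : ∀ i, 0 ≤ b i) (hd : ∀ i, 0 ≤ d i) (hp : ∀ i, 0 ≤ p i)
    (t1 : ∑ i, a i = ∑ i, b i + ∑ i, d i)
    (t2 : ∑ i, a i ^ 2 = ∑ i, b i ^ 2 + ∑ i, d i ^ 2 + 2 * ∑ i, p i ^ 2)
    (H : ∀ s : ℝ, 0 < s → 0 ≤ ∑ i, Real.log (1 + s * a i) - ∑ i, Real.log (1 + s * b i)
      - ∑ i, Real.log (1 + s * d i)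
      + (2 * ∑ i, Real.log (1 + s * p i) - ∑ i, Real.log (1 + s * (2 * p i)))) :
    0 ≤ ∑ i, a i ^ q - ∑ i, b i ^ q - ∑ i, d i ^ q + (2 - 2 ^ q) * ∑ i, p i ^ q := by
  have hq0 : 0 < q := by rcases hq with h | h <;> linarith [h.1]
  set F : ℝ → ℝ := fun q => ∑ i, a i ^ q - ∑ i, b i ^ q - ∑ i, d i ^ q + (2 - 2 ^ q) * ∑ i, p i ^ q with hF
  have hc1 : ∀ x : ℝ, ContinuousAt (fun q : ℝ => x ^ q) q := fun x => Real.continuousAt_const_rpow' hq0.ne'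
  have hc : ContinuousAt F q := by
    have hs1 : ContinuousAt (fun q : ℝ => ∑ i, a i ^ q) q := tendsto_finsetSum _ (fun i _ => hc1 (a i))
    have hs2 : ContinuousAt (fun q : ℝ => ∑ i, b i ^ q) q := tendsto_finsetSum _ (fun i _ => hc1 (b i))
    have hs3 : ContinuousAt (fun q : ℝ => ∑ i, d i ^ q) q := tendsto_finsetSum _ (fun i _ => hc1 (d i))
    have hs4 : ContinuousAt (fun q : ℝ => ∑ i, p i ^ q) q := tendsto_finsetSum _ (fun i _ => hc1 (p i))
    exact ((hs1.sub hs2).sub hs3).add ((continuousAt_const.sub (hc1 2)).mul hs4)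
  have key : ∀ u v : ℝ, u < v → q ∈ Set.Icc u v → (∀ y ∈ Set.Ioo u v, 0 ≤ F y) → 0 ≤ F q := by
    intro u v huv hmem hy
    rw [← closure_Ioo huv.ne] at hmem
    have := hc.continuousWithinAt (s := Set.Ioo u v) |>.mem_closure_image hmem
    exact closure_minimal (by rintro _ ⟨y, h, rfl⟩; exact hy y h) isClosed_Ici this
  rcases hq with h | h
  · exact key 0 1 (by norm_num) ⟨h.1.le, h.2⟩
      (fun y hy => nci_open y (Or.inl hy) a b d p ha hb hd hp t1 t2 H)
  · exact key 2 3 (by norm_num) h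
      (fun y hy => nci_open y (Or.inr hy) a b d p ha hb hd hp t1 t2 H)

theorem nci_trace_blocks {m n : ℕ}
    (B : Matrix (Fin m) (Fin m) ℂ) (E : Matrix (Fin m) (Fin n) ℂ) (C : Matrix (Fin n) (Fin m) ℂ)
    (D : Matrix (Fin n) (Fin n) ℂ) : (fromBlocks B E C D).trace = B.trace + D.trace := by
  simp [Matrix.trace, Fintype.sum_sum_type]

theorem nci_scale {ι : Type*} [Fintype ι] [DecidableEq ι] {M : Matrix ι ι ℂ}
    (hM : M.IsHermitian) (s : ℝ) (hM' : (s • M).IsHermitian) (f : ℝ → ℝ) :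
    ∑ i, f (hM'.eigenvalues i) = ∑ i, f (s * hM.eigenvalues i) := by
  have h1 := nci_trace_cfc hM' f
  have h2 := nci_trace_cfc hM (fun x => f (s * x))
  have h3 : cfc (fun x => f (s * x)) M = cfc f (s • M) := by
    refine cfc_comp_const_mul s f M ?_ hM.isSelfAdjoint
    exact ((Matrix.finite_real_spectrum (𝕜 := ℂ) (A := M)).image _).continuousOn f
  rw [← h3, h2] at h1
  exact_mod_cast h1.symm

theorem nci_trace_one {ι : Type*} [Fintype ι] [DecidableEq ι] {M : Matrix ι ι ℂ}
    (hM : M.IsHermitian) : M.trace = ((∑ i, hM.eigenvalues i : ℝ) : ℂ) := by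
  have h := nci_trace_cfc hM (fun x => x)
  rwa [cfc_id' ℝ M hM.isSelfAdjoint] at h

theorem nci_trace_two {ι : Type*} [Fintype ι] [DecidableEq ι] {M : Matrix ι ι ℂ}
    (hM : M.IsHermitian) : (M * M).trace = ((∑ i, hM.eigenvalues i ^ 2 : ℝ) : ℂ) := by
  have h := nci_trace_cfc hM (fun x => x ^ 2)
  rwa [cfc_pow_id (R := ℝ) M 2 hM.isSelfAdjoint, sq] at h

/-- Theorem 5.2, cases `0 < q ≤ 1` and `2 ≤ q ≤ 3`: the norm compression inequality for a positive
semidefinite block matrix `A = [[B, Cᴴ],[C, D]]`: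
`Tr(A^q) ≥ (2^q - 2)·Tr((CᴴC)^{q/2}) + Tr(B^q) + Tr(D^q)`. -/
theorem norm_compression_inequality_reversed {m n : ℕ}
    (B : Matrix (Fin m) (Fin m) ℂ) (D : Matrix (Fin n) (Fin n) ℂ)
    (C : Matrix (Fin n) (Fin m) ℂ)
    (hA : (Matrix.fromBlocks B Cᴴ C D).PosSemidef)
    (q : ℝ) (hq : (0 < q ∧ q ≤ 1) ∨ (2 ≤ q ∧ q ≤ 3)) :
    (matrixRpow (Matrix.fromBlocks B Cᴴ C D) q).trace ≥
      ((2 ^ q - 2 : ℝ) : ℂ) * (matrixRpow (Cᴴ * C) (q / 2)).trace +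
        (matrixRpow B q).trace + (matrixRpow D q).trace := by
  have hB : B.PosSemidef := by
    obtain ⟨Z1, Z2, h1, h2, h3⟩ := nci_factor B D C hA
    rw [← h1]; exact posSemidef_conjTranspose_mul_self _
  have hD : D.PosSemidef := by
    obtain ⟨Z1, Z2, h1, h2, h3⟩ := nci_factor B D C hA
    rw [← h2]; exact posSemidef_conjTranspose_mul_self _
  have hM : (Cᴴ * C).PosSemidef := posSemidef_conjTranspose_mul_self _
  have hμ0 := hM.eigenvalues_nonneg
  have key := nci_closed q hq hA.isHermitian.eigenvalues hB.isHermitian.eigenvalues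
    hD.isHermitian.eigenvalues (fun i => Real.sqrt (hM.isHermitian.eigenvalues i))
    hA.eigenvalues_nonneg hB.eigenvalues_nonneg hD.eigenvalues_nonneg (fun i => Real.sqrt_nonneg _)
    (by
      have := nci_trace_blocks B Cᴴ C D
      rw [nci_trace_one hA.isHermitian, nci_trace_one hB.isHermitian,
        nci_trace_one hD.isHermitian] at this
      exact_mod_cast this)
    (by
      have h1 := nci_trace_two hA.isHermitian
      rw [fromBlocks_multiply, nci_trace_blocks, trace_add, trace_add, nci_trace_two hB.isHermitian,
        nci_trace_two hD.isHermitian, trace_mul_comm C, nci_trace_one hM.isHermitian] at h1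
      simp only [Real.sq_sqrt (hμ0 _)]
      have h2 : ∑ i, hB.isHermitian.eigenvalues i ^ 2 + ∑ i, hM.isHermitian.eigenvalues i
        + (∑ i, hM.isHermitian.eigenvalues i + ∑ i, hD.isHermitian.eigenvalues i ^ 2)
        = ∑ i, hA.isHermitian.eigenvalues i ^ 2 := by exact_mod_cast h1
      linarith)
    (by
      intro s hs
      have eA : fromBlocks (s • B) (s • C)ᴴ (s • C) (s • D) = s • fromBlocks B Cᴴ C D := by
        rw [fromBlocks_smul, conjTranspose_smul]; simp
      have eM : (s • C)ᴴ * (s • C) = (s ^ 2) • (Cᴴ * C) := by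
        rw [conjTranspose_smul, Matrix.smul_mul, Matrix.mul_smul, smul_smul, sq]; simp
      have pA : (s • fromBlocks B Cᴴ C D).PosSemidef := hA.smul hs.le
      have pB : (s • B).PosSemidef := hB.smul hs.le
      have pD : (s • D).PosSemidef := hD.smul hs.le
      have pM : ((s ^ 2) • (Cᴴ * C)).PosSemidef := hM.smul (by positivity)
      have gen : ∀ (A' : Matrix (Fin m ⊕ Fin n) (Fin m ⊕ Fin n) ℂ) (M' : Matrix (Fin m) (Fin m) ℂ)
          (hA' : A'.PosSemidef) (hM' : M'.PosSemidef),
          A' = fromBlocks (s • B) (s • C)ᴴ (s • C) (s • D) → M' = (s • C)ᴴ * (s • C) →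
          0 ≤ ∑ i, Real.log (1 + hA'.isHermitian.eigenvalues i)
            - ∑ i, Real.log (1 + pB.isHermitian.eigenvalues i)
            - ∑ i, Real.log (1 + pD.isHermitian.eigenvalues i)
            + ∑ i, (2 * Real.log (1 + Real.sqrt (hM'.isHermitian.eigenvalues i))
              - Real.log (1 + 2 * Real.sqrt (hM'.isHermitian.eigenvalues i))) := by
        intro A' M' hA' hM' h1 h2
        subst h1 h2
        exact nci_point (s • B) (s • D) (s • C) hA' pB pD hM'
      have h := gen _ _ pA pM eA.symm eM.symm
      rw [nci_scale hA.isHermitian s pA.isHermitian (fun x => Real.log (1 + x)),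
        nci_scale hB.isHermitian s pB.isHermitian (fun x => Real.log (1 + x)),
        nci_scale hD.isHermitian s pD.isHermitian (fun x => Real.log (1 + x)),
        nci_scale hM.isHermitian (s ^ 2) pM.isHermitian
          (fun x => 2 * Real.log (1 + Real.sqrt x) - Real.log (1 + 2 * Real.sqrt x))] at h
      have es : ∀ x : ℝ, Real.sqrt (s ^ 2 * x) = s * Real.sqrt x := fun x => by
        rw [Real.sqrt_mul (sq_nonneg s), Real.sqrt_sq hs.le]
      simp only [es, Finset.sum_sub_distrib, ← Finset.mul_sum, mul_left_comm 2 s] at h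
      exact h)
  have ep : ∀ i, Real.sqrt (hM.isHermitian.eigenvalues i) ^ q
      = hM.isHermitian.eigenvalues i ^ (q / 2) := fun i => by
    rw [Real.sqrt_eq_rpow, ← Real.rpow_mul (hμ0 i)]; ring_nf
  simp only [ep] at key
  unfold matrixRpow
  rw [nci_trace_cfc hA.isHermitian, nci_trace_cfc hB.isHermitian, nci_trace_cfc hD.isHermitian,
    nci_trace_cfc hM.isHermitian, ge_iff_le, ← Complex.ofReal_mul, ← Complex.ofReal_add,
    ← Complex.ofReal_add]
  refine Complex.real_le_real.mpr ?_
  linarith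
end
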